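/- Every self-dual code of length 24 over F5 contains a nonzero codeword of Hamming weight at most 9. Equivalently, the largest minimum weight among self-dual codes of length 24 over F5 is at most 9. -/

import Mathlib

namespace SD24

/-- The ambient space. -/
abbrev V := Fin 24 → ZMod 5

/-- Self-duality. -/
def SelfDual (C : Submodule (ZMod 5) V) : Prop :=
  ∀ x : V, x ∈ C ↔ ∀ c ∈ C, ∑ i, x i * c i = 0

open Classical in
/-- The codewords, as a finset. -/
noncomputable def CF (C : Submodule (ZMod 5) V) : Finset V := Finset.univ.filter (· ∈ C)

theorem mem_CF {C : Submodule (ZMod 5) V} {c : V} : c ∈ CF C ↔ c ∈ C := by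
  simp [CF]

/-- The standard character. -/
noncomputable def psi : AddChar (ZMod 5) ℂ := ZMod.stdAddChar

/-- Fourier transform on `ZMod 5`. -/
noncomputable def hat (h : ZMod 5 → ℂ) (y : ZMod 5) : ℂ := ∑ x, h x * psi (x * y)

open Classical in
theorem char_sum {C : Submodule (ZMod 5) V} (hC : SelfDual C) (x : V) :
    ∑ c ∈ CF C, psi (∑ k, x k * c k) = if x ∈ C then ((CF C).card : ℂ) else 0 := by
  split_ifs with hx
  · rw [Finset.sum_congr rfl (g := fun _ => (1 : ℂ))]
    · simp
    · intro c hc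
      rw [(hC x).1 hx c (mem_CF.1 hc)]
      simp
  · have : ∃ c0 ∈ C, ∑ k, x k * c0 k ≠ 0 := by
      by_contra! h
      exact hx ((hC x).2 h)
    obtain ⟨c0, hc0, hne⟩ := this
    have h1 : psi (∑ k, x k * c0 k) ≠ 1 := by
      intro h
      apply hne
      apply ZMod.injective_stdAddChar
      simpa [psi] using h
    have h2 : ∑ c ∈ CF C, psi (∑ k, x k * c k)
        = psi (∑ k, x k * c0 k) * ∑ c ∈ CF C, psi (∑ k, x k * c k) := by
      rw [Finset.mul_sum]
      refine Finset.sum_bij' (fun c _ => c - c0) (fun c _ => c + c0) ?_ ?_ ?_ ?_ ?_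
      · intro c hc
        exact mem_CF.2 (C.sub_mem (mem_CF.1 hc) hc0)
      · intro c hc
        exact mem_CF.2 (C.add_mem (mem_CF.1 hc) hc0)
      · intro c _; simp
      · intro c _; simp
      · intro c _
        have e : ∑ k, x k * c k = ∑ k, x k * c0 k + ∑ k, x k * (c - c0) k := by
          rw [← Finset.sum_add_distrib]
          refine Finset.sum_congr rfl fun k _ => ?_
          rw [Pi.sub_apply, mul_sub]
          abel
        rw [e, AddChar.map_add_eq_mul]
    have h3 : (psi (∑ k, x k * c0 k) - 1) * ∑ c ∈ CF C, psi (∑ k, x k * c k) = 0 := by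
      linear_combination -h2
    rcases mul_eq_zero.1 h3 with h | h
    · exact absurd (sub_eq_zero.1 h) h1
    · exact h

theorem psi_sum (f : Fin 24 → ZMod 5) : psi (∑ k, f k) = ∏ k, psi (f k) := by
  classical
  have h : ∀ S : Finset (Fin 24), psi (∑ k ∈ S, f k) = ∏ k ∈ S, psi (f k) := by
    intro S
    induction S using Finset.induction_on with
    | empty => simp
    | insert a S ha ih =>
      rw [Finset.sum_insert ha, Finset.prod_insert ha, AddChar.map_add_eq_mul, ih]
  exact h _

theorem poisson0 {C : Submodule (ZMod 5) V} (hC : SelfDual C) (h : Fin 24 → ZMod 5 → ℂ) :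
    ∑ c ∈ CF C, ∏ k, hat (h k) (c k) = ((CF C).card : ℂ) * ∑ c ∈ CF C, ∏ k, h k (c k) := by
  classical
  have h1 : ∀ c : V, ∏ k, hat (h k) (c k)
      = ∑ x : V, (∏ k, h k (x k)) * psi (∑ k, x k * c k) := by
    intro c
    unfold hat
    rw [Finset.prod_univ_sum, Fintype.piFinset_univ]
    refine Finset.sum_congr rfl fun x _ => ?_
    rw [Finset.prod_mul_distrib]
    congr 1
    exact (psi_sum _).symm
  simp_rw [h1]
  rw [Finset.sum_comm]
  simp_rw [← Finset.mul_sum, char_sum hC]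
  rw [Finset.mul_sum]
  unfold CF
  rw [Finset.sum_filter]
  refine Finset.sum_congr rfl fun x _ => ?_
  split_ifs <;> ring

theorem hat_one (y : ZMod 5) : hat (fun _ => 1) y = if y = 0 then 5 else 0 := by
  unfold hat
  have := AddChar.sum_mulShift (ψ := psi) y (ZMod.isPrimitive_stdAddChar 5)
  simp only [one_mul]
  rw [this]
  simp

theorem card_CF {C : Submodule (ZMod 5) V} (hC : SelfDual C) : (CF C).card = 5 ^ 12 := by
  have h := poisson0 hC (fun _ _ => 1)
  simp only [hat_one, Finset.prod_const_one, Finset.sum_const, nsmul_eq_mul, mul_one] at h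
  have h2 : ∑ c ∈ CF C, ∏ k : Fin 24, (if c k = 0 then (5:ℂ) else 0) = 5 ^ 24 := by
    rw [Finset.sum_eq_single 0]
    · simp
    · intro c _ hc
      obtain ⟨k, hk⟩ : ∃ k, c k ≠ 0 := by
        by_contra! h
        exact hc (funext h)
      exact Finset.prod_eq_zero (Finset.mem_univ k) (by simp [hk])
    · intro h
      exact absurd (mem_CF.2 C.zero_mem) h
  rw [h2] at h
  have h3 : (5:ℕ)^24 = (CF C).card * (CF C).card := by exact_mod_cast h
  have h4 : (CF C).card ^ 2 = (5 ^ 12) ^ 2 := by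
    rw [sq, ← h3]; norm_num
  exact (Nat.pow_left_injective (by norm_num : (2:ℕ) ≠ 0)) h4

theorem poisson {C : Submodule (ZMod 5) V} (hC : SelfDual C) (h : Fin 24 → ZMod 5 → ℂ) :
    ∑ c ∈ CF C, ∏ k, hat (h k) (c k) = 5 ^ 12 * ∑ c ∈ CF C, ∏ k, h k (c k) := by
  rw [poisson0 hC, card_CF hC]
  norm_num

end SD24

namespace SD24

/-- Minimum weight at least 10. -/
def MinWt (C : Submodule (ZMod 5) V) : Prop := ∀ c ∈ C, c ≠ 0 → 10 ≤ hammingNorm c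

/-- Functions that are sums of functions of at most `n` coordinates. -/
def Deg (n : ℕ) : Submodule ℂ (V → ℂ) :=
  Submodule.span ℂ {F | ∃ S : Finset (Fin 24), S.card ≤ n ∧
    ∃ h : Fin 24 → ZMod 5 → ℂ, F = fun c => ∏ k ∈ S, h k (c k)}

theorem Deg.mul {m n : ℕ} {F G : V → ℂ} (hF : F ∈ Deg m) (hG : G ∈ Deg n) :
    F * G ∈ Deg (m + n) := by
  classical
  unfold Deg at hF
  induction hF using Submodule.span_induction with
  | zero => simp
  | add F₁ F₂ _ _ h₁ h₂ => rw [add_mul]; exact Submodule.add_mem _ h₁ h₂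
  | smul a F _ h => rw [smul_mul_assoc]; exact Submodule.smul_mem _ _ h
  | mem F hF =>
    obtain ⟨S, hS, h, rfl⟩ := hF
    unfold Deg at hG
    induction hG using Submodule.span_induction with
    | zero => simp
    | add F₁ F₂ _ _ h₁ h₂ => rw [mul_add]; exact Submodule.add_mem _ h₁ h₂
    | smul a F _ h => rw [mul_smul_comm]; exact Submodule.smul_mem _ _ h
    | mem G hG =>
      obtain ⟨S', hS', h', rfl⟩ := hG
      refine Submodule.subset_span ⟨S ∪ S', (Finset.card_union_le _ _).trans (by omega),
        fun k x => (if k ∈ S then h k x else 1) * (if k ∈ S' then h' k x else 1), ?_⟩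
      funext c
      simp only [Pi.mul_apply]
      rw [Finset.prod_mul_distrib]
      congr 1
      · rw [Finset.prod_ite_mem, Finset.union_inter_cancel_left]
      · rw [Finset.prod_ite_mem, Finset.union_inter_cancel_right]

theorem Deg.const (a : ℂ) : (fun _ => a) ∈ Deg 0 := by
  have : (fun _ => a : V → ℂ) = a • (fun _ => 1) := by funext c; simp
  rw [this]
  exact Submodule.smul_mem _ _ (Submodule.subset_span ⟨∅, by simp, fun _ _ => 1, by simp⟩)

theorem Deg.single (k : Fin 24) (h : ZMod 5 → ℂ) : (fun c => h (c k)) ∈ Deg 1 :=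
  Submodule.subset_span ⟨{k}, by simp, fun _ => h, by simp⟩

theorem Deg.mono {m n : ℕ} (hmn : m ≤ n) {F : V → ℂ} (hF : F ∈ Deg m) : F ∈ Deg n := by
  refine Submodule.span_mono ?_ hF
  rintro F ⟨S, hS, h, rfl⟩
  exact ⟨S, hS.trans hmn, h, rfl⟩

theorem Deg.additive (h : Fin 24 → ZMod 5 → ℂ) : (fun c => ∑ k, h k (c k)) ∈ Deg 1 := by
  have : (fun c => ∑ k, h k (c k) : V → ℂ) = ∑ k, (fun c : V => h k (c k)) := by
    funext c; simp
  rw [this]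
  exact Submodule.sum_mem _ fun k _ => Deg.single k (h k)

theorem Deg.pow {m : ℕ} {F : V → ℂ} (hF : F ∈ Deg m) (j : ℕ) : F ^ j ∈ Deg (j * m) := by
  induction j with
  | zero => rw [pow_zero, zero_mul]; exact Deg.const 1
  | succ j ih => rw [pow_succ, Nat.succ_mul]; exact Deg.mul ih hF

theorem strength {C : Submodule (ZMod 5) V} (hC : SelfDual C) (hm : MinWt C)
    {F : V → ℂ} (hF : F ∈ Deg 9) : 5 ^ 12 * ∑ c ∈ CF C, F c = ∑ x : V, F x := by
  classical
  unfold Deg at hF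
  induction hF using Submodule.span_induction with
  | zero => simp
  | add F₁ F₂ _ _ h₁ h₂ => simp only [Pi.add_apply, Finset.sum_add_distrib, mul_add, h₁, h₂]
  | smul a F _ h =>
    simp only [Pi.smul_apply, smul_eq_mul, ← Finset.mul_sum, ← h]
    ring
  | mem F hF =>
    obtain ⟨S, hS, h, rfl⟩ := hF
    have e : ∀ c : V, ∏ k ∈ S, h k (c k) = ∏ k, (if k ∈ S then h k else fun _ => 1) (c k) := by
      intro c
      rw [← Finset.prod_subset (Finset.subset_univ S)]
      · exact Finset.prod_congr rfl fun k hk => by simp [hk]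
      · intro k _ hk; simp [hk]
    simp only [e]
    rw [← poisson hC, Finset.sum_eq_single 0]
    · unfold hat
      rw [Finset.prod_univ_sum, Fintype.piFinset_univ]
      simp
    · intro c hc h0
      have h1 := hm c (mem_CF.1 hc) h0
      obtain ⟨k, hk, hkS⟩ : ∃ k, c k ≠ 0 ∧ k ∉ S := by
        by_contra! h2
        have : hammingNorm c ≤ S.card := by
          unfold hammingNorm
          apply Finset.card_le_card
          intro k hk
          exact h2 k (by simpa using hk)
        omega
      refine Finset.prod_eq_zero (Finset.mem_univ k) ?_
      simp [hkS, hat_one, hk]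
    · intro h
      exact absurd (mem_CF.2 C.zero_mem) h

/-- Legendre symbol mod 5. -/
def chi : ZMod 5 → ℤ := ![0, 1, -1, -1, 1]
/-- Odd function supported on `±1`. -/
def o1 : ZMod 5 → ℤ := ![0, 1, 0, 0, -1]
/-- Odd function supported on `±2`. -/
def o2 : ZMod 5 → ℤ := ![0, 0, 1, -1, 0]
/-- Indicator of nonzero elements. -/
def nz : ZMod 5 → ℤ := ![0, 1, 1, 1, 1]

/-- number of `±1` minus number of `±2`. -/
def D {n : ℕ} (c : Fin n → ZMod 5) : ℤ := ∑ k, chi (c k)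
/-- weight -/
def wt {n : ℕ} (c : Fin n → ZMod 5) : ℤ := ∑ k, nz (c k)

theorem DegD : (fun c : V => ((D c : ℤ) : ℂ)) ∈ Deg 1 := by
  have := Deg.additive (fun _ x => ((chi x : ℤ) : ℂ))
  simpa [D] using this

theorem Degwt : (fun c : V => ((wt c : ℤ) : ℂ)) ∈ Deg 1 := by
  have := Deg.additive (fun _ x => ((nz x : ℤ) : ℂ))
  simpa [wt] using this

/-- Integer form of the strength property. -/
theorem strengthZ {C : Submodule (ZMod 5) V} (hC : SelfDual C) (hm : MinWt C)
    {F : V → ℤ} (hF : (fun c => (F c : ℂ)) ∈ Deg 9) :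
    5 ^ 12 * ∑ c ∈ CF C, F c = ∑ x : V, F x := by
  have := strength hC hm hF
  exact_mod_cast this

/-- The degree-7 polynomial vanishing at all admissible `D` except `±20`. -/
def p (t : ℤ) : ℤ := t * (t ^ 2 - 25) * (t ^ 2 - 100) * (t ^ 2 - 225)

theorem Degp : (fun c : V => ((p (D c) : ℤ) : ℂ)) ∈ Deg 7 := by
  have hD := DegD
  have h2 : ∀ a : ℂ, (fun c : V => ((D c : ℤ) : ℂ) ^ 2 - a) ∈ Deg 2 := by
    intro a
    exact Submodule.sub_mem _ (Deg.pow hD 2) (Deg.mono (by norm_num) (Deg.const a))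
  have := Deg.mul (Deg.mul (Deg.mul hD (h2 25)) (h2 100)) (h2 225)
  convert this using 1
  funext c
  simp [p]

/-- Recursion for the moments of `D` over the whole space. -/
def mom : ℕ → ℤ × ℤ × ℤ × ℤ × ℤ
  | 0 => (1, 0, 0, 0, 0)
  | n + 1 =>
    let (m0, m2, m4, m6, m8) := mom n
    (5 * m0, 5 * m2 + 4 * m0, 5 * m4 + 4 * (6 * m2 + m0), 5 * m6 + 4 * (15 * m4 + 15 * m2 + m0),
      5 * m8 + 4 * (28 * m6 + 70 * m4 + 28 * m2 + m0))

theorem sum_chi (g : ℤ → ℤ) : ∑ x : ZMod 5, g (chi x) = g 0 + 2 * g 1 + 2 * g (-1) := by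
  have : ∑ x : ZMod 5, g (chi x)
      = g (chi 0) + g (chi 1) + g (chi 2) + g (chi 3) + g (chi 4) := Fin.sum_univ_five _
  rw [this]
  have h0 : chi 0 = 0 := rfl
  have h1 : chi 1 = 1 := rfl
  have h2 : chi 2 = -1 := rfl
  have h3 : chi 3 = -1 := rfl
  have h4 : chi 4 = 1 := rfl
  rw [h0, h1, h2, h3, h4]
  ring

/-- Isolating one coordinate in a sum over the whole space. -/
theorem sum_isolate {n : ℕ} (i : Fin (n + 1)) (g : ZMod 5 → ℤ → ℤ) :
    ∑ x : Fin (n + 1) → ZMod 5, g (x i) (D x)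
      = ∑ y : Fin n → ZMod 5, ∑ t : ZMod 5, g t (chi t + D y) := by
  rw [← (Fin.insertNthEquiv (fun _ => ZMod 5) i).sum_comp, Fintype.sum_prod_type,
    Finset.sum_comm]
  refine Finset.sum_congr rfl fun y _ => Finset.sum_congr rfl fun t _ => ?_
  simp [D, Fin.sum_univ_succAbove _ i]

theorem mom_spec (n : ℕ) :
    mom n = (∑ _x : Fin n → ZMod 5, 1, ∑ x : Fin n → ZMod 5, D x ^ 2,
      ∑ x : Fin n → ZMod 5, D x ^ 4, ∑ x : Fin n → ZMod 5, D x ^ 6,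
      ∑ x : Fin n → ZMod 5, D x ^ 8) := by
  induction n with
  | zero => simp [mom, D]
  | succ n ih =>
    rw [mom, ih]
    simp only [sum_isolate 0 (fun _ d => d ^ 2), sum_isolate 0 (fun _ d => d ^ 4),
      sum_isolate 0 (fun _ d => d ^ 6), sum_isolate 0 (fun _ d => d ^ 8),
      sum_isolate 0 (fun _ _ => 1)]
    simp only [Prod.mk.injEq, Finset.mul_sum, ← Finset.sum_add_distrib]
    refine ⟨?_, ?_, ?_, ?_, ?_⟩
    all_goals refine Finset.sum_congr rfl fun y _ => ?_
    · simp
    · rw [sum_chi (fun a => (a + D y) ^ 2)]; ring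
    · rw [sum_chi (fun a => (a + D y) ^ 4)]; ring
    · rw [sum_chi (fun a => (a + D y) ^ 6)]; ring
    · rw [sum_chi (fun a => (a + D y) ^ 8)]; ring

theorem mom23 :
    ∑ _x : Fin 23 → ZMod 5, (1:ℤ) = (mom 23).1 ∧
    ∑ x : Fin 23 → ZMod 5, D x ^ 2 = (mom 23).2.1 ∧
    ∑ x : Fin 23 → ZMod 5, D x ^ 4 = (mom 23).2.2.1 ∧
    ∑ x : Fin 23 → ZMod 5, D x ^ 6 = (mom 23).2.2.2.1 ∧
    ∑ x : Fin 23 → ZMod 5, D x ^ 8 = (mom 23).2.2.2.2 := by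
  rw [mom_spec 23]
  simp only [and_self]

theorem sum_zero_mark (i : Fin 24) :
    ∑ x : V, (1 - nz (x i)) * (D x * p (D x)) = 0 := by
  rw [sum_isolate i (fun t d => (1 - nz t) * (d * p d))]
  have e : ∀ y : Fin 23 → ZMod 5, ∑ t : ZMod 5, (1 - nz t) * ((chi t + D y) * p (chi t + D y))
      = D y ^ 8 - 350 * D y ^ 6 + 30625 * D y ^ 4 - 562500 * D y ^ 2 := by
    intro y
    have : ∀ f : ZMod 5 → ℤ, ∑ t : ZMod 5, f t = f 0 + f 1 + f 2 + f 3 + f 4 :=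
      fun f => Fin.sum_univ_five _
    rw [this]
    have h0 : nz 0 = 0 := rfl
    have h1 : nz 1 = 1 := rfl
    have h2 : nz 2 = 1 := rfl
    have h3 : nz 3 = 1 := rfl
    have h4 : nz 4 = 1 := rfl
    have h5 : chi 0 = 0 := rfl
    rw [h0, h1, h2, h3, h4, h5]
    unfold p
    ring
  simp only [e, Finset.sum_add_distrib, Finset.sum_sub_distrib, ← Finset.mul_sum]
  obtain ⟨-, h2, h4, h6, h8⟩ := mom23
  rw [h2, h4, h6, h8]
  decide +kernel

theorem sum_chi_mark (i : Fin 24) :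
    ∑ x : V, chi (x i) * p (D x) = 5 ^ 12 * (2 * 480 * p 20) := by
  rw [sum_isolate i (fun t d => chi t * p d)]
  have e : ∀ y : Fin 23 → ZMod 5, ∑ t : ZMod 5, chi t * p (chi t + D y)
      = 28 * D y ^ 6 + (-6860) * D y ^ 4 + 353584 * D y ^ 2 + (-2128896) * 1 := by
    intro y
    rw [sum_chi (fun a => a * p (a + D y))]
    unfold p
    ring
  simp only [e, Finset.sum_add_distrib, ← Finset.mul_sum]
  obtain ⟨h0, h2, h4, h6, h8⟩ := mom23
  rw [h0, h2, h4, h6]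
  decide +kernel

end SD24

namespace SD24

theorem nz_wt (c : V) : wt c = hammingNorm c := by
  unfold wt hammingNorm
  rw [Finset.card_filter]
  push_cast
  refine Finset.sum_congr rfl fun k _ => ?_
  have : ∀ x : ZMod 5, nz x = if x ≠ 0 then 1 else 0 := by decide
  exact this _

theorem wt_le (c : V) : wt c ≤ 24 := by
  have : wt c ≤ ∑ _k : Fin 24, 1 := by
    refine Finset.sum_le_sum fun k _ => ?_
    have : ∀ x : ZMod 5, nz x ≤ 1 := by decide
    exact this _
  simpa using this

theorem D_le (c : V) : D c ≤ wt c ∧ -wt c ≤ D c := by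
  constructor
  · refine Finset.sum_le_sum fun k _ => ?_
    have : ∀ x : ZMod 5, chi x ≤ nz x := by decide
    exact this _
  · unfold D wt
    rw [← Finset.sum_neg_distrib]
    refine Finset.sum_le_sum fun k _ => ?_
    have : ∀ x : ZMod 5, -nz x ≤ chi x := by decide
    exact this _

theorem five_dvd {C : Submodule (ZMod 5) V} (hC : SelfDual C) {c : V} (hc : c ∈ C) :
    (5:ℤ) ∣ D c := by
  have h := (hC c).1 hc c hc
  rw [← Int.cast_zero, show (5:ℤ) = ((5:ℕ):ℤ) from rfl, ← ZMod.intCast_zmod_eq_zero_iff_dvd] at *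
  have e : ((D c : ℤ) : ZMod 5) = ∑ k, c k * c k := by
    unfold D
    push_cast
    refine Finset.sum_congr rfl fun k _ => ?_
    have : ∀ x : ZMod 5, ((chi x : ℤ) : ZMod 5) = x * x := by decide
    exact this _
  rw [e, h]
  simp

theorem p_eq_zero {d : ℤ} (h5 : 5 ∣ d) (h1 : d ≤ 24) (h2 : -24 ≤ d) (h3 : d ≠ 20)
    (h4 : d ≠ -20) : p d = 0 := by
  obtain ⟨e, rfl⟩ := h5
  have : -4 ≤ e := by omega
  have : e ≤ 4 := by omega
  interval_cases e <;> first | rfl | omega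

theorem pD_eq_zero {C : Submodule (ZMod 5) V} (hC : SelfDual C) {c : V} (hc : c ∈ C)
    (h3 : D c ≠ 20) (h4 : D c ≠ -20) : p (D c) = 0 := by
  have := wt_le c
  have := D_le c
  exact p_eq_zero (five_dvd hC hc) (by omega) (by omega) h3 h4

/-- Step 1: words with `D = ±20` have full weight. -/
theorem full_wt {C : Submodule (ZMod 5) V} (hC : SelfDual C) (hm : MinWt C) {c : V}
    (hc : c ∈ C) (hD : D c = 20 ∨ D c = -20) : wt c = 24 := by
  have hdeg : (fun c : V => (((24 - wt c) * (D c * p (D c)) : ℤ) : ℂ)) ∈ Deg 9 := by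
    have h1 : (fun c : V => ((24:ℂ) - (wt c : ℤ))) ∈ Deg 1 :=
      Submodule.sub_mem _ (Deg.mono (by norm_num) (Deg.const 24)) Degwt
    have := Deg.mul h1 (Deg.mul DegD Degp)
    convert this using 1
    funext c
    simp
  have h := strengthZ hC hm hdeg
  have h0 : ∑ x : V, (24 - wt x) * (D x * p (D x)) = 0 := by
    have e : ∀ x : V, (24 - wt x) * (D x * p (D x))
        = ∑ i : Fin 24, (1 - nz (x i)) * (D x * p (D x)) := by
      intro x
      rw [← Finset.sum_mul]
      simp [wt]
    simp only [e]
    rw [Finset.sum_comm]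
    exact Finset.sum_eq_zero fun i _ => sum_zero_mark i
  rw [h0] at h
  have h2 : ∑ c ∈ CF C, (24 - wt c) * (D c * p (D c)) = 0 := by
    rcases mul_eq_zero.1 h with h | h
    · norm_num at h
    · exact h
  have hnn : ∀ c ∈ CF C, 0 ≤ (24 - wt c) * (D c * p (D c)) := by
    intro c hc
    have hc := mem_CF.1 hc
    have h24 := wt_le c
    apply mul_nonneg (by omega)
    by_cases h3 : D c = 20
    · rw [h3]; decide
    by_cases h4 : D c = -20
    · rw [h4]; decide
    rw [pD_eq_zero hC hc h3 h4]; simp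
  have h5 := (Finset.sum_eq_zero_iff_of_nonneg hnn).1 h2 c (mem_CF.2 hc)
  rcases mul_eq_zero.1 h5 with h | h
  · omega
  · exfalso
    rcases hD with hD | hD <;> rw [hD] at h <;> revert h <;> decide

/-- The words with `D = 20`. -/
noncomputable def ShW (C : Submodule (ZMod 5) V) : Finset V := (CF C).filter (fun c => D c = 20)

theorem mem_ShW {C : Submodule (ZMod 5) V} {c : V} : c ∈ ShW C ↔ c ∈ C ∧ D c = 20 := by
  simp [ShW, mem_CF]

theorem chi_two (x : ZMod 5) : chi (2 * x) = -chi x := by revert x; decide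
theorem o1_two (x : ZMod 5) : o1 (2 * x) = -o2 x := by revert x; decide
theorem o2_two (x : ZMod 5) : o2 (2 * x) = o1 x := by revert x; decide

theorem D_two (c : V) : D (fun k => 2 * c k) = - D c := by
  simp [D, chi_two]

theorem two_mem {C : Submodule (ZMod 5) V} {c : V} (hc : c ∈ C) : (fun k => 2 * c k) ∈ C := by
  exact C.smul_mem (2 : ZMod 5) hc

theorem six_mul (x : ZMod 5) : 2 * (3 * x) = x := by revert x; decide
theorem six_mul' (x : ZMod 5) : 3 * (2 * x) = x := by revert x; decide

/-- Scaling invariance of sums over the code. -/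
theorem sum_two {M : Type*} [AddCommMonoid M] {C : Submodule (ZMod 5) V} (f : V → M) :
    ∑ c ∈ CF C, f (fun k => 2 * c k) = ∑ c ∈ CF C, f c := by
  refine Finset.sum_bij' (fun c _ k => 2 * c k) (fun c _ k => 3 * c k) ?_ ?_ ?_ ?_ ?_
  · intro c hc; exact mem_CF.2 (two_mem (mem_CF.1 hc))
  · intro c hc; exact mem_CF.2 (C.smul_mem (3 : ZMod 5) (mem_CF.1 hc))
  · intro c _; funext k; exact six_mul' _
  · intro c _; funext k; exact six_mul _
  · intro c _; rfl

theorem sum_p {C : Submodule (ZMod 5) V} (hC : SelfDual C) (f : V → ℤ) :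
    ∑ c ∈ CF C, f c * p (D c)
      = p 20 * (∑ c ∈ ShW C, f c - ∑ c ∈ ShW C, f (fun k => 2 * c k)) := by
  have e1 : ∑ c ∈ ShW C, f c = ∑ c ∈ CF C, if D c = 20 then f c else 0 := by
    rw [ShW, Finset.sum_filter]
  have e2 : ∑ c ∈ ShW C, f (fun k => 2 * c k) = ∑ c ∈ CF C, if D c = -20 then f c else 0 := by
    rw [ShW, Finset.sum_filter, ← sum_two (fun c => if D c = -20 then f c else 0)]
    refine Finset.sum_congr rfl fun c _ => ?_
    simp [D_two]
  rw [e1, e2, ← Finset.sum_sub_distrib, Finset.mul_sum]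
  refine Finset.sum_congr rfl fun c hc => ?_
  have hc := mem_CF.1 hc
  by_cases h3 : D c = 20
  · rw [h3]; norm_num; ring
  by_cases h4 : D c = -20
  · rw [h4]
    have : p (-20) = - p 20 := by decide
    rw [this]; norm_num; ring
  rw [pD_eq_zero hC hc h3 h4]
  simp [h3, h4]

theorem p20_ne : p 20 ≠ 0 := by decide

theorem sum_chi_ShW {C : Submodule (ZMod 5) V} (hC : SelfDual C) (hm : MinWt C) (i : Fin 24) :
    ∑ c ∈ ShW C, chi (c i) = 480 := by
  have hdeg : (fun c : V => ((chi (c i) * p (D c) : ℤ) : ℂ)) ∈ Deg 9 := by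
    have := Deg.mul (Deg.single i (fun x => ((chi x : ℤ) : ℂ))) Degp
    refine Deg.mono (m := 8) (by norm_num) ?_
    convert this using 1
    funext c
    simp
  have h := strengthZ hC hm hdeg
  rw [sum_chi_mark, sum_p hC (fun c => chi (c i))] at h
  simp only [chi_two, Finset.sum_neg_distrib] at h
  have h2 := mul_left_cancel₀ (by norm_num) h
  have h3 : p 20 * (2 * ∑ c ∈ ShW C, chi (c i)) = p 20 * (2 * 480) := by linarith
  have h4 := mul_left_cancel₀ p20_ne h3
  linarith

theorem card_ShW {C : Submodule (ZMod 5) V} (hC : SelfDual C) (hm : MinWt C) :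
    (ShW C).card = 576 := by
  have h1 : ∑ c ∈ ShW C, D c = 24 * 480 := by
    unfold D
    rw [Finset.sum_comm, Finset.sum_congr rfl (fun i _ => sum_chi_ShW hC hm i)]
    simp
  have h2 : ∑ c ∈ ShW C, D c = ∑ c ∈ ShW C, 20 :=
    Finset.sum_congr rfl fun c hc => (mem_ShW.1 hc).2
  rw [h2] at h1
  simp only [Finset.sum_const, nsmul_eq_mul] at h1
  omega

theorem ne_zero_of_ShW {C : Submodule (ZMod 5) V} (hC : SelfDual C) (hm : MinWt C) {c : V}
    (hc : c ∈ ShW C) (k : Fin 24) : c k ≠ 0 := by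
  have h := full_wt hC hm (mem_ShW.1 hc).1 (Or.inl (mem_ShW.1 hc).2)
  have h2 : hammingNorm c = 24 := by
    have := nz_wt c
    omega
  have h3 : (Finset.univ.filter (fun k => c k ≠ 0)) = Finset.univ := by
    apply Finset.eq_univ_of_card
    simpa [hammingNorm] using h2
  have := Finset.mem_univ k
  rw [← h3] at this
  simpa using this

/-- design equations with two odd marks -/
theorem odd_design {C : Submodule (ZMod 5) V} (hC : SelfDual C) (hm : MinWt C) {i j : Fin 24}
    (hij : i ≠ j) (u v : ZMod 5 → ℤ) (hu : ∀ x, u (-x) = - u x) (F : V → ℤ)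
    (hF : (fun c => (F c : ℂ)) ∈ Deg 7)
    (hneg : ∀ c : V, F (Function.update c i (-c i)) = F c) :
    ∑ c ∈ CF C, u (c i) * v (c j) * F c = 0 := by
  have hdeg : (fun c : V => ((u (c i) * v (c j) * F c : ℤ) : ℂ)) ∈ Deg 9 := by
    have := Deg.mul (Deg.mul (Deg.single i (fun x => ((u x : ℤ) : ℂ)))
      (Deg.single j (fun x => ((v x : ℤ) : ℂ)))) hF
    convert this using 1
    funext c
    simp
  have h := strengthZ hC hm hdeg
  have h0 : ∑ c : V, u (c i) * v (c j) * F c = 0 := by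
    have hinv : Function.Involutive (fun c : V => Function.update c i (-c i)) := by
      intro c
      simp
    let e : Equiv.Perm V := hinv.toPerm
    have h1 : ∑ c : V, u (e c i) * v (e c j) * F (e c) = ∑ c : V, u (c i) * v (c j) * F c :=
      Equiv.sum_comp e (fun c => u (c i) * v (c j) * F c)
    have h2 : ∑ c : V, u (e c i) * v (e c j) * F (e c)
        = - ∑ c : V, u (c i) * v (c j) * F c := by
      rw [← Finset.sum_neg_distrib]
      refine Finset.sum_congr rfl fun c _ => ?_
      have e' : e c = Function.update c i (-c i) := rfl
      rw [e', hneg]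
      simp [hu, Function.update_of_ne hij.symm]
    rw [h2] at h1
    linarith
  rw [h0] at h
  rcases mul_eq_zero.1 h with h | h
  · norm_num at h
  · exact h

theorem o1_neg (x : ZMod 5) : o1 (-x) = -o1 x := by revert x; decide
theorem o2_neg (x : ZMod 5) : o2 (-x) = -o2 x := by revert x; decide
theorem chi_neg (x : ZMod 5) : chi (-x) = chi x := by revert x; decide
theorem nz_neg (x : ZMod 5) : nz (-x) = nz x := by revert x; decide

theorem D_upd (c : V) (i : Fin 24) : D (Function.update c i (-c i)) = D c := by
  unfold D
  refine Finset.sum_congr rfl fun k _ => ?_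
  by_cases hk : k = i
  · subst hk; simp [chi_neg]
  · simp [Function.update_of_ne hk]

theorem wt_upd (c : V) (i : Fin 24) : wt (Function.update c i (-c i)) = wt c := by
  unfold wt
  refine Finset.sum_congr rfl fun k _ => ?_
  by_cases hk : k = i
  · subst hk; simp [nz_neg]
  · simp [Function.update_of_ne hk]

theorem O11_eq_O22 {C : Submodule (ZMod 5) V} (hC : SelfDual C) (hm : MinWt C) {i j : Fin 24}
    (hij : i ≠ j) :
    ∑ c ∈ ShW C, o1 (c i) * o1 (c j) = ∑ c ∈ ShW C, o2 (c i) * o2 (c j) := by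
  have h := odd_design hC hm hij o1 o1 o1_neg (fun c => p (D c)) Degp
    (fun c => by simp only [D_upd])
  rw [sum_p hC (fun c => o1 (c i) * o1 (c j))] at h
  simp only [o1_two, neg_mul_neg] at h
  rcases mul_eq_zero.1 h with h | h
  · exact absurd h p20_ne
  · linarith

theorem O12_add_O21 {C : Submodule (ZMod 5) V} (hC : SelfDual C) (hm : MinWt C) {i j : Fin 24}
    (hij : i ≠ j) :
    ∑ c ∈ ShW C, o1 (c i) * o2 (c j) + ∑ c ∈ ShW C, o2 (c i) * o1 (c j) = 0 := by
  have h := odd_design hC hm hij o1 o2 o1_neg (fun c => p (D c)) Degp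
    (fun c => by simp only [D_upd])
  rw [sum_p hC (fun c => o1 (c i) * o2 (c j))] at h
  simp only [o1_two, o2_two, neg_mul, Finset.sum_neg_distrib] at h
  rcases mul_eq_zero.1 h with h | h
  · exact absurd h p20_ne
  · linarith

end SD24

namespace SD24

/-- indicator of 0 -/
def i0 : ZMod 5 → ℕ := ![1, 0, 0, 0, 0]
/-- indicator of ±1 -/
def i1 : ZMod 5 → ℕ := ![0, 1, 0, 0, 1]
/-- indicator of ±2 -/
def i2 : ZMod 5 → ℕ := ![0, 0, 1, 1, 0]

/-- even function with given values -/
def ev (x y z : ℂ) : ZMod 5 → ℂ := ![x, y, z, z, y]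

/-- coordinates other than `i`, `j` -/
def rest (i j : Fin 24) : Finset (Fin 24) := (Finset.univ.erase i).erase j

/-- number of `±1` among the rest -/
def aa (i j : Fin 24) (c : V) : ℕ := ∑ k ∈ rest i j, i1 (c k)
/-- number of `±2` among the rest -/
def bb (i j : Fin 24) (c : V) : ℕ := ∑ k ∈ rest i j, i2 (c k)

theorem zz_eq {i j : Fin 24} (hij : i ≠ j) (c : V) :
    ∑ k ∈ rest i j, i0 (c k) = 22 - aa i j c - bb i j c ∧ aa i j c + bb i j c ≤ 22 := by
  have h : ∑ k ∈ rest i j, i0 (c k) + aa i j c + bb i j c = 22 := by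
    unfold aa bb
    rw [← Finset.sum_add_distrib, ← Finset.sum_add_distrib]
    have : ∀ x : ZMod 5, i0 x + i1 x + i2 x = 1 := by decide
    simp only [this, Finset.sum_const, smul_eq_mul, mul_one]
    unfold rest
    rw [Finset.card_erase_of_mem, Finset.card_erase_of_mem]
    · simp
    · simp
    · simp [hij.symm]
  omega

theorem sum_split {M : Type*} [AddCommMonoid M] {i j : Fin 24} (hij : i ≠ j) (f : Fin 24 → M) :
    ∑ k, f k = f i + (f j + ∑ k ∈ rest i j, f k) := by
  unfold rest
  rw [Finset.add_sum_erase _ _ (by simp [hij.symm]), Finset.add_sum_erase _ _ (by simp)]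

theorem prod_split {i j : Fin 24} (hij : i ≠ j) (f : Fin 24 → ℂ) :
    ∏ k, f k = f i * (f j * ∏ k ∈ rest i j, f k) := by
  unfold rest
  rw [Finset.mul_prod_erase _ _ (by simp [hij.symm]), Finset.mul_prod_erase _ _ (by simp)]

theorem ev_apply (x y z : ℂ) (t : ZMod 5) : ev x y z t = x ^ i0 t * y ^ i1 t * z ^ i2 t := by
  have : ∀ t : Fin 5, (ev x y z t : ℂ) = x ^ i0 t * y ^ i1 t * z ^ i2 t := by
    intro t
    fin_cases t <;> simp [ev, i0, i1, i2]
  exact this t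

theorem prod_ev {i j : Fin 24} (hij : i ≠ j) (x y z : ℂ) (c : V) :
    ∏ k ∈ rest i j, ev x y z (c k)
      = x ^ (22 - aa i j c - bb i j c) * y ^ (aa i j c) * z ^ (bb i j c) := by
  simp only [ev_apply, Finset.prod_mul_distrib, Finset.prod_pow_eq_pow_sum]
  rw [(zz_eq hij c).1]
  rfl

/-- `√5` as a Gauss sum. -/
noncomputable def gg : ℂ := psi 1 + psi 4 - psi 2 - psi 3

theorem psi_rel : psi 2 = psi 1 ^ 2 ∧ psi 3 = psi 1 ^ 3 ∧ psi 4 = psi 1 ^ 4 ∧ psi 1 ^ 5 = 1 ∧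
    1 + psi 1 + psi 1 ^ 2 + psi 1 ^ 3 + psi 1 ^ 4 = 0 := by
  have h2 : psi 2 = psi 1 ^ 2 := by
    rw [← AddChar.map_nsmul_eq_pow]; rfl
  have h3 : psi 3 = psi 1 ^ 3 := by
    rw [← AddChar.map_nsmul_eq_pow]; rfl
  have h4 : psi 4 = psi 1 ^ 4 := by
    rw [← AddChar.map_nsmul_eq_pow]; rfl
  have h5 : psi 1 ^ 5 = 1 := by
    rw [← AddChar.map_nsmul_eq_pow]
    have : (5 • (1 : ZMod 5)) = 0 := rfl
    rw [this]; simp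
  refine ⟨h2, h3, h4, h5, ?_⟩
  have h := hat_one 1
  have e : hat (fun _ => 1) 1 = psi 0 + psi 1 + psi 2 + psi 3 + psi 4 := by
    unfold hat
    simp only [one_mul, mul_one]
    exact Fin.sum_univ_five _
  rw [e, h2, h3, h4, if_neg (by decide)] at h
  simpa using h

theorem gg_sq : gg ^ 2 = 5 := by
  obtain ⟨h2, h3, h4, h5, h⟩ := psi_rel
  unfold gg
  rw [h2, h3, h4]
  set w := psi 1
  linear_combination (-1) * h + (w ^ 3 - 2 * w ^ 2 - w + 4) * h5

theorem hat_expand (h : ZMod 5 → ℂ) (y : ZMod 5) :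
    hat h y = h 0 * psi 0 + h 1 * psi y + h 2 * psi (2 * y) + h 3 * psi (3 * y)
      + h 4 * psi (4 * y) := by
  unfold hat
  have : ∀ f : ZMod 5 → ℂ, ∑ t : ZMod 5, f t = f 0 + f 1 + f 2 + f 3 + f 4 :=
    fun f => Fin.sum_univ_five _
  rw [this, zero_mul, one_mul]

theorem zmod_cases (P : ZMod 5 → Prop) (h0 : P 0) (h1 : P 1) (h2 : P 2) (h3 : P 3) (h4 : P 4)
    (t : ZMod 5) : P t := by
  have : ∀ t : Fin 5, P t := by
    intro t
    fin_cases t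
    · exact h0
    · exact h1
    · exact h2
    · exact h3
    · exact h4
  exact this t

theorem hat_ev (x p q : ℂ) : hat (ev x (p + q) (p - q))
    = ev (x + 4 * p) (x - p + q * gg) (x - p - q * gg) := by
  obtain ⟨h2, h3, h4, h5, h⟩ := psi_rel
  have s : psi 1 + psi 2 + psi 3 + psi 4 = -1 := by
    rw [h2, h3, h4]; linear_combination h
  funext t
  rw [hat_expand]
  have z0 : psi 0 = 1 := by simp
  have a0 : ∀ x y z, ev x y z 0 = x := fun _ _ _ => rfl
  have a1 : ∀ x y z, ev x y z 1 = y := fun _ _ _ => rfl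
  have a2 : ∀ x y z, ev x y z 2 = z := fun _ _ _ => rfl
  have a3 : ∀ x y z, ev x y z 3 = z := fun _ _ _ => rfl
  have a4 : ∀ x y z, ev x y z 4 = y := fun _ _ _ => rfl
  rw [z0, a0, a1, a2, a3, a4]
  revert t
  apply zmod_cases
  · simp only [mul_zero, z0, a0]; ring
  · simp only [mul_one, a1, gg]; linear_combination p * s
  · rw [show (2:ZMod 5) * 2 = 4 from rfl, show (3:ZMod 5) * 2 = 1 from rfl,
      show (4:ZMod 5) * 2 = 3 from rfl, a2]
    unfold gg; linear_combination p * s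
  · rw [show (2:ZMod 5) * 3 = 1 from rfl, show (3:ZMod 5) * 3 = 4 from rfl,
      show (4:ZMod 5) * 3 = 2 from rfl, a3]
    unfold gg; linear_combination p * s
  · rw [show (2:ZMod 5) * 4 = 3 from rfl, show (3:ZMod 5) * 4 = 2 from rfl,
      show (4:ZMod 5) * 4 = 1 from rfl, a4]
    unfold gg; linear_combination p * s

/-- complex version of `o1` -/
noncomputable def c1 (x : ZMod 5) : ℂ := (o1 x : ℤ)
/-- complex version of `o2` -/
noncomputable def c2 (x : ZMod 5) : ℂ := (o2 x : ℤ)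

theorem c1_vals : c1 0 = 0 ∧ c1 1 = 1 ∧ c1 2 = 0 ∧ c1 3 = 0 ∧ c1 4 = -1 := by
  have h : o1 0 = 0 ∧ o1 1 = 1 ∧ o1 2 = 0 ∧ o1 3 = 0 ∧ o1 4 = -1 := by decide
  obtain ⟨h0, h1, h2, h3, h4⟩ := h
  simp [c1, h0, h1, h2, h3, h4]

theorem c2_vals : c2 0 = 0 ∧ c2 1 = 0 ∧ c2 2 = 1 ∧ c2 3 = -1 ∧ c2 4 = 0 := by
  have h : o2 0 = 0 ∧ o2 1 = 0 ∧ o2 2 = 1 ∧ o2 3 = -1 ∧ o2 4 = 0 := by decide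
  obtain ⟨h0, h1, h2, h3, h4⟩ := h
  simp [c2, h0, h1, h2, h3, h4]

theorem hat_c1 (t : ZMod 5) :
    hat c1 t = (psi 1 - psi 4) * c1 t + (psi 2 - psi 3) * c2 t := by
  obtain ⟨a0, a1, a2, a3, a4⟩ := c1_vals
  obtain ⟨b0, b1, b2, b3, b4⟩ := c2_vals
  rw [hat_expand, a0, a1, a2, a3, a4]
  revert t
  apply zmod_cases
  · rw [a0, b0]; simp
  · rw [a1, b1, mul_one (4 : ZMod 5)]; ring
  · rw [a2, b2, show (4:ZMod 5) * 2 = 3 from rfl]; ring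
  · rw [a3, b3, show (4:ZMod 5) * 3 = 2 from rfl]; ring
  · rw [a4, b4, show (4:ZMod 5) * 4 = 1 from rfl]; ring

theorem hat_c2 (t : ZMod 5) :
    hat c2 t = (psi 2 - psi 3) * c1 t - (psi 1 - psi 4) * c2 t := by
  obtain ⟨a0, a1, a2, a3, a4⟩ := c1_vals
  obtain ⟨b0, b1, b2, b3, b4⟩ := c2_vals
  rw [hat_expand, b0, b1, b2, b3, b4]
  revert t
  apply zmod_cases
  · rw [a0, b0]; simp
  · rw [a1, b1, mul_one (2 : ZMod 5), mul_one (3 : ZMod 5)]; ring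
  · rw [a2, b2, show (2:ZMod 5) * 2 = 4 from rfl, show (3:ZMod 5) * 2 = 1 from rfl]; ring
  · rw [a3, b3, show (2:ZMod 5) * 3 = 1 from rfl, show (3:ZMod 5) * 3 = 4 from rfl]; ring
  · rw [a4, b4, show (2:ZMod 5) * 4 = 3 from rfl, show (3:ZMod 5) * 4 = 2 from rfl]; ring

theorem hat_kappa (s t : ZMod 5) :
    hat c1 s * hat c1 t + hat c2 s * hat c2 t = -5 * (c1 s * c1 t + c2 s * c2 t) := by
  have h : (psi 1 - psi 4) ^ 2 + (psi 2 - psi 3) ^ 2 = -5 := by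
    obtain ⟨h2, h3, h4, h5, h⟩ := psi_rel
    rw [h2, h3, h4]
    set w := psi 1
    linear_combination h + (w ^ 3 + w - 4) * h5
  rw [hat_c1, hat_c1, hat_c2, hat_c2]
  linear_combination (c1 s * c1 t + c2 s * c2 t) * h

/-- Poisson summation with two equal marks. -/
theorem poisson_mark {C : Submodule (ZMod 5) V} (hC : SelfDual C) {i j : Fin 24} (hij : i ≠ j)
    (u f : ZMod 5 → ℂ) :
    ∑ c ∈ CF C, hat u (c i) * hat u (c j) * ∏ k ∈ rest i j, hat f (c k)
      = 5 ^ 12 * ∑ c ∈ CF C, u (c i) * u (c j) * ∏ k ∈ rest i j, f (c k) := by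
  have h := poisson hC (fun k => if k = i then u else if k = j then u else f)
  have hr : ∀ k ∈ rest i j, k ≠ i ∧ k ≠ j := by
    intro k hk
    simp only [rest, Finset.mem_erase, Finset.mem_univ, and_true] at hk
    exact ⟨hk.2, hk.1⟩
  have e1 : ∀ c : V, ∏ k, hat (if k = i then u else if k = j then u else f) (c k)
      = hat u (c i) * hat u (c j) * ∏ k ∈ rest i j, hat f (c k) := by
    intro c
    rw [prod_split hij, mul_assoc]
    simp only [if_true, if_neg hij.symm]
    congr 2
    refine Finset.prod_congr rfl fun k hk => ?_
    rw [if_neg (hr k hk).1, if_neg (hr k hk).2]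
  have e2 : ∀ c : V, ∏ k, (if k = i then u else if k = j then u else f) (c k)
      = u (c i) * u (c j) * ∏ k ∈ rest i j, f (c k) := by
    intro c
    rw [prod_split hij, mul_assoc]
    simp only [if_true, if_neg hij.symm]
    congr 2
    refine Finset.prod_congr rfl fun k hk => ?_
    rw [if_neg (hr k hk).1, if_neg (hr k hk).2]
  simp only [e1, e2] at h
  exact h

theorem ev_two (x y z : ℂ) (t : ZMod 5) : ev x y z (2 * t) = ev x z y t := by
  revert t
  apply zmod_cases <;> rfl

/-- combine `o1 o1` and `o2 o2` marks by scaling -/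
theorem kappa_sum {C : Submodule (ZMod 5) V} {i j : Fin 24} (hij : i ≠ j) (x y z : ℂ) :
    ∑ c ∈ CF C, (c1 (c i) * c1 (c j) + c2 (c i) * c2 (c j)) * ∏ k ∈ rest i j, ev x y z (c k)
      = ∑ c ∈ CF C, c1 (c i) * c1 (c j) * (x ^ (22 - aa i j c - bb i j c) *
        (y ^ (aa i j c) * z ^ (bb i j c) + z ^ (aa i j c) * y ^ (bb i j c))) := by
  have e : ∑ c ∈ CF C, c2 (c i) * c2 (c j) * ∏ k ∈ rest i j, ev x y z (c k)
      = ∑ c ∈ CF C, c1 (c i) * c1 (c j) * ∏ k ∈ rest i j, ev x z y (c k) := by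
    rw [← sum_two]
    refine Finset.sum_congr rfl fun c _ => ?_
    simp only [ev_two, c2, o2_two, c1]
  simp only [add_mul, Finset.sum_add_distrib]
  rw [e, ← Finset.sum_add_distrib]
  refine Finset.sum_congr rfl fun c _ => ?_
  rw [prod_ev hij, prod_ev hij]
  ring

/-- powers of `u + v √5` -/
def pw (u v : ℤ) : ℕ → ℤ × ℤ
  | 0 => (1, 0)
  | n + 1 => let r := pw u v n
    (u * r.1 + 5 * v * r.2, u * r.2 + v * r.1)

theorem pw_spec (u v : ℤ) (n : ℕ) :
    ((u : ℂ) + v * gg) ^ n = (pw u v n).1 + (pw u v n).2 * gg ∧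
    ((u : ℂ) - v * gg) ^ n = (pw u v n).1 - (pw u v n).2 * gg := by
  have hg := gg_sq
  induction n with
  | zero => simp [pw]
  | succ n ih =>
    rw [pow_succ, pow_succ, ih.1, ih.2]
    simp only [pw]
    push_cast
    constructor
    · linear_combination ((pw u v n).2 : ℂ) * v * hg
    · linear_combination ((pw u v n).2 : ℂ) * v * hg

/-- The integer coefficient of the MacWilliams equation with parameters `x, p, q`. -/
def EE (x p q : ℤ) (a b : ℕ) : ℤ :=
  5 ^ 11 * (x ^ (22 - a - b) * ((p + q) ^ a * (p - q) ^ b + (p - q) ^ a * (p + q) ^ b)) +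
    (x + 4 * p) ^ (22 - a - b) * (2 * ((pw (x - p) q a).1 * (pw (x - p) q b).1
      - 5 * ((pw (x - p) q a).2 * (pw (x - p) q b).2)))

theorem macwilliams {C : Submodule (ZMod 5) V} (hC : SelfDual C) {i j : Fin 24} (hij : i ≠ j)
    (x p q : ℤ) :
    ∑ c ∈ CF C, o1 (c i) * o1 (c j) * EE x p q (aa i j c) (bb i j c) = 0 := by
  have h1 := poisson_mark hC hij c1 (ev x (p + q) (p - q))
  have h2 := poisson_mark hC hij c2 (ev x (p + q) (p - q))
  have h3 : ∑ c ∈ CF C, -5 * ((c1 (c i) * c1 (c j) + c2 (c i) * c2 (c j)) *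
        ∏ k ∈ rest i j, hat (ev x (p + q) (p - q)) (c k))
      = 5 ^ 12 * ∑ c ∈ CF C, (c1 (c i) * c1 (c j) + c2 (c i) * c2 (c j)) *
        ∏ k ∈ rest i j, ev x (p + q) (p - q) (c k) := by
    have e := congrArg₂ (· + ·) h1 h2
    simp only [← mul_add, ← Finset.sum_add_distrib, ← add_mul] at e
    rw [← e]
    refine Finset.sum_congr rfl fun c _ => ?_
    rw [hat_kappa]
    ring
  rw [← Finset.mul_sum, hat_ev, kappa_sum hij, kappa_sum hij] at h3
  have h4 : ((∑ c ∈ CF C, o1 (c i) * o1 (c j) * EE x p q (aa i j c) (bb i j c) : ℤ) : ℂ)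
      = 5 ^ 11 * ∑ c ∈ CF C, c1 (c i) * c1 (c j) * (x ^ (22 - aa i j c - bb i j c) *
        ((p + q : ℂ) ^ (aa i j c) * (p - q) ^ (bb i j c)
          + (p - q : ℂ) ^ (aa i j c) * (p + q) ^ (bb i j c)))
      + ∑ c ∈ CF C, c1 (c i) * c1 (c j) * ((x + 4 * p : ℂ) ^ (22 - aa i j c - bb i j c) *
        ((x - p + q * gg : ℂ) ^ (aa i j c) * (x - p - q * gg) ^ (bb i j c)
          + (x - p - q * gg : ℂ) ^ (aa i j c) * (x - p + q * gg) ^ (bb i j c))) := by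
    rw [Finset.mul_sum, ← Finset.sum_add_distrib]
    push_cast
    refine Finset.sum_congr rfl fun c _ => ?_
    have ha := pw_spec (x - p) q (aa i j c)
    have hb := pw_spec (x - p) q (bb i j c)
    push_cast at ha hb
    rw [ha.1, ha.2, hb.1, hb.2]
    unfold EE c1
    push_cast
    linear_combination (-2 * (o1 (c i) : ℂ) * (o1 (c j) : ℂ) *
      ((x + 4 * p : ℂ) ^ (22 - aa i j c - bb i j c)) * -((pw (x - p) q (aa i j c)).2 : ℂ) *
        ((pw (x - p) q (bb i j c)).2 : ℂ)) * gg_sq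
  have h5 : ((∑ c ∈ CF C, o1 (c i) * o1 (c j) * EE x p q (aa i j c) (bb i j c) : ℤ) : ℂ) = 0 := by
    rw [h4]
    linear_combination (-1/5) * h3
  exact_mod_cast h5

theorem poly_design {C : Submodule (ZMod 5) V} (hC : SelfDual C) (hm : MinWt C) {i j : Fin 24}
    (hij : i ≠ j) (e f : ℕ) (hef : e + f ≤ 7) :
    ∑ c ∈ CF C, o1 (c i) * o1 (c j) * ((wt c - 18) ^ e * D c ^ f) = 0 := by
  refine odd_design hC hm hij o1 o1 o1_neg (fun c => (wt c - 18) ^ e * D c ^ f) ?_ ?_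
  · have h1 : (fun c : V => (((wt c : ℤ) : ℂ) - 18)) ∈ Deg 1 :=
      Submodule.sub_mem _ Degwt (Deg.mono (by norm_num) (Deg.const 18))
    have := Deg.mul (Deg.pow h1 e) (Deg.pow DegD f)
    refine Deg.mono (m := e * 1 + f * 1) (by omega) ?_
    convert this using 1
    funext c
    simp
  · intro c
    simp only [D_upd, wt_upd]

/-- Polynomial part of the certificate: `(coefficient, i, j)` for `(wt - 18)^i * D^j`. -/
def polyCert : List (ℤ × ℕ × ℕ) :=
  [(69420858733349568673663203901440, 0, 0),
   (-8882155626046114939339368038400, 0, 1),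
   (-8366507610365771810022172262400, 0, 2),
   (471144764267237745089556480000, 0, 3),
   (115705400977521528256742400000, 0, 4),
   (-4781412311267958501316608000, 0, 5),
   (-313517881621716714948096000, 0, 6),
   (9507740380899023174400000, 0, 7),
   (-17009842929788543606162949734400, 1, 0),
   (2121696636753517929604251648000, 1, 1),
   (1801046631129969373197078528000, 1, 2),
   (-107751635242012655289446400000, 1, 3),
   (-20781383661570728138342400000, 1, 4),
   (878801833648193501813760000, 1, 5),
   (30651893769008640280320000, 1, 6),
   (2432000448024472815422865408000, 2, 0),
   (-366920523953839410760396800000, 2, 1),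
   (-200604637249465387828377600000, 2, 2),
   (15812944322926991656550400000, 2, 3),
   (1742148968303260599667200000, 2, 4),
   (-121240708721994885408000000, 2, 5),
   (87179013912522841151238144000, 3, 0),
   (21523999593563535140352000000, 3, 1),
   (-3605407245373675101696000000, 3, 2),
   (-390009246253094635776000000, 3, 3),
   (-12259297259176913568000000, 3, 4),
   (1195700838952279872844800000, 4, 0),
   (4954288689943733032704000000, 4, 1),
   (223135573957415550144000000, 4, 2),
   (27387926362841335200000000, 4, 3),
   (6420575653306718864486400000, 5, 0),
   (-727941518728743989376000000, 5, 1),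
   (134476837297496223264000000, 5, 2),
   (-404646875662757910336000000, 6, 0),
   (-182143990535435560800000000, 6, 1),
   (-190930902244202794464000000, 7, 0)]

/-- MacWilliams part of the certificate: `(coefficient, x, p, q)`. -/
def evalCert : List (ℤ × ℤ × ℤ × ℤ) :=
  [(-1103225710866713189941248, 0, 0, 1),
   (1028128426420896859815936, 0, 1, 0),
   (-45470194016300306104320, -1, 0, 1),
   (-469680789002958222778368, -1, 1, 0),
   (-22483060084400410215, 0, 1, 1),
   (62670096193594982400, -2, 0, 1),
   (2027978513316232429568, -2, 1, 0),
   (185438268739584000, -1, 0, 2),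
   (34453602163060899840, -1, 1, 1),
   (-327570185018630144, -1, 2, 0)]
/-- The certificate function. -/
def cert (a b : ℕ) : ℤ :=
  (polyCert.map fun t => t.1 * (((a + b : ℕ) - 16 : ℤ) ^ t.2.1 * ((a : ℤ) - b + 2) ^ t.2.2)).sum +
  (evalCert.map fun t => t.1 * EE t.2.1 t.2.2.1 t.2.2.2 a b).sum

theorem cert_check : ∀ a ∈ Finset.range 23, ∀ b ∈ Finset.range (23 - a),
    8 ≤ a + b → (a + 2) % 5 = b % 5 → (a + 2 = b + 20 → a + b = 22) →
    ¬ (a = 20 ∧ b = 2) → cert a b = 0 := by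
  decide +kernel

theorem cert_ne : cert 20 2 ≠ 0 := by decide +kernel

theorem sum_list_zero {α : Type*} (S : Finset V) (m : V → ℤ) (l : List α) (coef : α → ℤ)
    (f : α → V → ℤ) (h : ∀ t ∈ l, ∑ c ∈ S, m c * f t c = 0) :
    ∑ c ∈ S, m c * (l.map fun t => coef t * f t c).sum = 0 := by
  induction l with
  | nil => simp
  | cons t l ih =>
    simp only [List.map_cons, List.sum_cons, mul_add, Finset.sum_add_distrib]
    rw [ih (fun t ht => h t (List.mem_cons_of_mem _ ht)), add_zero]
    have e : ∀ c, m c * (coef t * f t c) = coef t * (m c * f t c) := fun c => by ring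
    simp only [e, ← Finset.mul_sum]
    rw [h t List.mem_cons_self, mul_zero]

theorem o1_ne {x : ZMod 5} (h : o1 x ≠ 0) : chi x = 1 ∧ nz x = 1 := by
  revert x; decide

theorem D_rest {i j : Fin 24} (hij : i ≠ j) {c : V} (h : o1 (c i) * o1 (c j) ≠ 0) :
    D c = (aa i j c : ℤ) - bb i j c + 2 ∧ wt c = ((aa i j c + bb i j c : ℕ) : ℤ) + 2 := by
  have hi := o1_ne (left_ne_zero_of_mul h)
  have hj := o1_ne (right_ne_zero_of_mul h)
  have k1 : ∀ x : ZMod 5, chi x = (i1 x : ℤ) - i2 x := by decide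
  have k2 : ∀ x : ZMod 5, nz x = (i1 x : ℤ) + i2 x := by decide
  constructor
  · unfold D aa bb
    rw [sum_split hij, hi.1, hj.1]
    simp only [k1, Finset.sum_sub_distrib]
    push_cast
    ring
  · unfold wt aa bb
    rw [sum_split hij, hi.2, hj.2]
    simp only [k2, Finset.sum_add_distrib]
    push_cast
    ring

theorem polyCert_deg : ∀ t ∈ polyCert, t.2.1 + t.2.2 ≤ 7 := by decide

theorem cert_sum {C : Submodule (ZMod 5) V} (hC : SelfDual C) (hm : MinWt C) {i j : Fin 24}
    (hij : i ≠ j) :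
    ∑ c ∈ CF C, o1 (c i) * o1 (c j) * cert (aa i j c) (bb i j c) = 0 := by
  have h1 := sum_list_zero (CF C) (fun c => o1 (c i) * o1 (c j)) polyCert (fun t => t.1)
    (fun t c => (wt c - 18) ^ t.2.1 * D c ^ t.2.2)
    (fun t ht => poly_design hC hm hij t.2.1 t.2.2 (polyCert_deg t ht))
  have h2 := sum_list_zero (CF C) (fun c => o1 (c i) * o1 (c j)) evalCert (fun t => t.1)
    (fun t c => EE t.2.1 t.2.2.1 t.2.2.2 (aa i j c) (bb i j c))
    (fun t _ => macwilliams hC hij _ _ _)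
  have h3 := congrArg₂ (· + ·) h1 h2
  simp only [← Finset.sum_add_distrib, add_zero] at h3
  rw [← h3]
  refine Finset.sum_congr rfl fun c _ => ?_
  by_cases h : o1 (c i) * o1 (c j) = 0
  · rw [h]; ring
  · obtain ⟨e1, e2⟩ := D_rest hij h
    unfold cert
    rw [e1, e2, ← mul_add]
    have : (((aa i j c + bb i j c : ℕ) : ℤ) + 2 - 18) = ((aa i j c + bb i j c : ℕ) : ℤ) - 16 := by
      ring
    rw [this]

theorem O11_zero {C : Submodule (ZMod 5) V} (hC : SelfDual C) (hm : MinWt C) {i j : Fin 24}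
    (hij : i ≠ j) : ∑ c ∈ ShW C, o1 (c i) * o1 (c j) = 0 := by
  have h := cert_sum hC hm hij
  have e : ∑ c ∈ CF C, o1 (c i) * o1 (c j) * cert (aa i j c) (bb i j c)
      = (∑ c ∈ ShW C, o1 (c i) * o1 (c j)) * cert 20 2 := by
    rw [ShW, Finset.sum_filter, Finset.sum_mul]
    refine Finset.sum_congr rfl fun c hc => ?_
    have hc := mem_CF.1 hc
    by_cases h0 : o1 (c i) * o1 (c j) = 0
    · rw [h0]; simp
    obtain ⟨e1, e2⟩ := D_rest hij h0
    have hle := (zz_eq hij c).2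
    have h5 := five_dvd hC hc
    have hne : c ≠ 0 := by
      rintro rfl
      exact h0 (show o1 0 * o1 0 = 0 by decide)
    have h10 := hm c hc hne
    have hw := nz_wt c
    split_ifs with hD
    · have h24 := full_wt hC hm hc (Or.inl hD)
      have ha : aa i j c = 20 := by omega
      have hb : bb i j c = 2 := by omega
      rw [ha, hb]
    · rw [cert_check (aa i j c) (by simp; omega) (bb i j c) (by simp; omega) (by omega)
        (by omega) (by omega) (by omega)]
      simp
  rw [e] at h
  rcases mul_eq_zero.1 h with h | h
  · exact h
  · exact absurd h cert_ne

/-- The lift of a word to an integer vector. -/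
def dl : ZMod 5 → ℤ := ![0, 1, -3, 3, -1]

theorem frame {C : Submodule (ZMod 5) V} (hC : SelfDual C) (hm : MinWt C) (i j : Fin 24) :
    ∑ c ∈ ShW C, dl (c i) * dl (c j) = if i = j then 960 else 0 := by
  split_ifs with hij
  · subst hij
    have e : ∑ c ∈ ShW C, dl (c i) * dl (c i) = ∑ c ∈ ShW C, (5 - 4 * chi (c i)) := by
      refine Finset.sum_congr rfl fun c hc => ?_
      have h := ne_zero_of_ShW hC hm hc i
      have : ∀ x : ZMod 5, x ≠ 0 → dl x * dl x = 5 - 4 * chi x := by decide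
      exact this _ h
    rw [e, Finset.sum_sub_distrib, ← Finset.mul_sum, sum_chi_ShW hC hm, Finset.sum_const,
      card_ShW hC hm]
    norm_num
  · have e : ∀ x : ZMod 5, dl x = o1 x - 3 * o2 x := by decide
    have e2 : ∑ c ∈ ShW C, dl (c i) * dl (c j) = ∑ c ∈ ShW C, o1 (c i) * o1 (c j)
        - 3 * (∑ c ∈ ShW C, o1 (c i) * o2 (c j) + ∑ c ∈ ShW C, o2 (c i) * o1 (c j))
        + 9 * ∑ c ∈ ShW C, o2 (c i) * o2 (c j) := by
      rw [← Finset.sum_add_distrib, Finset.mul_sum, Finset.mul_sum, ← Finset.sum_sub_distrib,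
        ← Finset.sum_add_distrib]
      refine Finset.sum_congr rfl fun c _ => ?_
      rw [e, e]
      ring
    rw [e2, O12_add_O21 hC hm hij, ← O11_eq_O22 hC hm hij, O11_zero hC hm hij]
    norm_num

end SD24

namespace SD24

/-- Integer vectors. -/
abbrev W := Fin 24 → ℤ

/-- Integer vectors reducing to a codeword. -/
def inC (C : Submodule (ZMod 5) V) (x : W) : Prop := (fun k => (x k : ZMod 5)) ∈ C

section lattice
variable {C : Submodule (ZMod 5) V}

theorem inC.add {x y : W} (hx : inC C x) (hy : inC C y) : inC C (x + y) := by
  have := C.add_mem hx hy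
  unfold inC
  convert this using 1
  funext k
  simp

theorem inC.neg {x : W} (hx : inC C x) : inC C (-x) := by
  have := C.neg_mem hx
  unfold inC
  convert this using 1
  funext k
  simp

theorem inC.sub {x y : W} (hx : inC C x) (hy : inC C y) : inC C (x - y) := by
  rw [sub_eq_add_neg]
  exact hx.add hy.neg

theorem inC.half {x : W} (hx : inC C ((2:ℤ) • x)) : inC C x := by
  have := C.smul_mem (3 : ZMod 5) hx
  unfold inC
  convert this using 1
  funext k
  have h : ∀ t : ZMod 5, t = 3 * (2 * t) := by decide
  simp only [Pi.smul_apply, smul_eq_mul, Int.cast_mul]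
  exact h _

theorem inC.two {x : W} (hx : inC C x) : inC C ((2:ℤ) • x) := by
  rw [two_smul]
  exact hx.add hx

theorem five_dvd_dot (hC : SelfDual C) {x y : W} (hx : inC C x) (hy : inC C y) :
    (5:ℤ) ∣ x ⬝ᵥ y := by
  have h := (hC _).1 hx _ hy
  rw [show (5:ℤ) = ((5:ℕ):ℤ) from rfl, ← ZMod.intCast_zmod_eq_zero_iff_dvd]
  rw [← h]
  simp [dotProduct]

theorem coord_sq_le (x : W) (k : Fin 24) : x k * x k ≤ x ⬝ᵥ x :=
  Finset.single_le_sum (f := fun k => x k * x k) (fun i _ => mul_self_nonneg (x i))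
    (Finset.mem_univ k)

theorem dot_self_nonneg (x : W) : 0 ≤ x ⬝ᵥ x :=
  Finset.sum_nonneg fun i _ => mul_self_nonneg (x i)

/-- lower bound on norms of vectors not divisible by 5 -/
theorem norm_key (hm : MinWt C) {x : W} (hx : inC C x)
    (h25 : x ⬝ᵥ x < 25) (h0 : x ≠ 0) :
    10 ≤ ∑ k, (if x k = 0 then (0:ℤ) else 1) := by
  have hne : (fun k => (x k : ZMod 5)) ≠ 0 := by
    intro h
    obtain ⟨k, hk⟩ : ∃ k, x k ≠ 0 := by
      by_contra! h
      exact h0 (funext h)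
    have h1 : ((x k : ℤ) : ZMod 5) = 0 := congrFun h k
    rw [ZMod.intCast_zmod_eq_zero_iff_dvd] at h1
    obtain ⟨e, he⟩ := h1
    have h2 := coord_sq_le x k
    have h3 : e ≠ 0 := by rintro rfl; simp at he; exact hk he
    have h4 : 1 ≤ e * e := by
      have := mul_self_pos.2 h3
      omega
    rw [he] at h2
    push_cast at h2
    nlinarith
  have h := hm _ hx hne
  have h2 : hammingNorm (fun k => (x k : ZMod 5)) ≤ (Finset.univ.filter (fun k => x k ≠ 0)).card := by
    unfold hammingNorm
    apply Finset.card_le_card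
    intro k hk
    simp only [Finset.mem_filter, Finset.mem_univ, true_and] at hk ⊢
    intro h
    exact hk (by simp [h])
  have h3 : ((Finset.univ.filter (fun k => x k ≠ 0)).card : ℤ)
      = ∑ k, (if x k = 0 then (0:ℤ) else 1) := by
    rw [Finset.card_filter]
    push_cast
    refine Finset.sum_congr rfl fun k _ => ?_
    split_ifs <;> simp_all
  rw [← h3]
  exact_mod_cast h.trans h2

theorem ind_le (t : ℤ) : (if t = 0 then (0:ℤ) else 1) ≤ t * t := by
  split_ifs with h
  · simp [h]
  · have := mul_self_pos.2 h
    omega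

theorem norm_lt (hm : MinWt C) {x : W} (hx : inC C x) (h : x ⬝ᵥ x < 10) : x = 0 := by
  by_contra h0
  have h1 := norm_key hm hx (by omega) h0
  have h2 : ∑ k, (if x k = 0 then (0:ℤ) else 1) ≤ x ⬝ᵥ x :=
    Finset.sum_le_sum fun k _ => ind_le (x k)
  omega

theorem norm_ten (hm : MinWt C) {x : W} (hx : inC C x) (h : x ⬝ᵥ x = 10) (k : Fin 24) :
    x k ≤ 1 ∧ -1 ≤ x k := by
  have h0 : x ≠ 0 := by rintro rfl; simp at h
  have h1 := norm_key hm hx (by omega) h0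
  have h2 : x k * x k - (if x k = 0 then (0:ℤ) else 1)
      ≤ ∑ k, (x k * x k - (if x k = 0 then (0:ℤ) else 1)) :=
    Finset.single_le_sum (f := fun k => x k * x k - (if x k = 0 then (0:ℤ) else 1))
      (fun i _ => sub_nonneg.2 (ind_le (x i))) (Finset.mem_univ k)
  rw [Finset.sum_sub_distrib] at h2
  have h3 : ∑ k, x k * x k = 10 := h
  have h4 : (if x k = 0 then (0:ℤ) else 1) ≤ 1 := by split_ifs <;> norm_num
  have h5 : x k * x k ≤ 1 := by omega
  constructor <;> nlinarith

open Classical in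
/-- norm 40 vectors with odd entries -/
noncomputable def Sh (C : Submodule (ZMod 5) V) : Finset W :=
  (Fintype.piFinset fun _ => Finset.Icc (-3:ℤ) 3).filter
    (fun x => inC C x ∧ (∀ k, Odd (x k)) ∧ x ⬝ᵥ x = 40)

open Classical in
/-- norm 10 vectors -/
noncomputable def R (C : Submodule (ZMod 5) V) : Finset W :=
  (Fintype.piFinset fun _ => Finset.Icc (-3:ℤ) 3).filter (fun x => inC C x ∧ x ⬝ᵥ x = 10)

theorem odd_sq {t : ℤ} (h : Odd t) : 1 ≤ t * t := by
  have : t ≠ 0 := by rintro rfl; simp at h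
  have := mul_self_pos.2 this
  omega

theorem odd_norm {x : W} (h : ∀ k, Odd (x k)) (k : Fin 24) : x k * x k + 23 ≤ x ⬝ᵥ x := by
  have h2 : x k * x k - 1 ≤ ∑ k, (x k * x k - 1) :=
    Finset.single_le_sum (f := fun k => x k * x k - 1)
      (fun i _ => sub_nonneg.2 (odd_sq (h i))) (Finset.mem_univ k)
  rw [Finset.sum_sub_distrib] at h2
  have h3 : ∑ k, x k * x k = x ⬝ᵥ x := rfl
  simp at h2
  omega

theorem odd_bound {x : W} (h : ∀ k, Odd (x k)) (h40 : x ⬝ᵥ x = 40) (k : Fin 24) :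
    x k ≤ 3 ∧ -3 ≤ x k := by
  have h1 := odd_norm h k
  have h2 : x k * x k ≤ 17 := by omega
  obtain ⟨e, he⟩ := h k
  have : x k ≤ 4 := by nlinarith
  have : -4 ≤ x k := by nlinarith
  constructor <;> omega

theorem mem_Sh {x : W} : x ∈ Sh C ↔ inC C x ∧ (∀ k, Odd (x k)) ∧ x ⬝ᵥ x = 40 := by
  classical
  unfold Sh
  simp only [Finset.mem_filter]
  constructor
  · exact fun h => h.2
  · intro h
    refine ⟨?_, h⟩
    rw [Fintype.mem_piFinset]
    intro k
    rw [Finset.mem_Icc]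
    have := odd_bound h.2.1 h.2.2 k
    omega

theorem mem_R {x : W} : x ∈ R C ↔ inC C x ∧ x ⬝ᵥ x = 10 := by
  classical
  unfold R
  simp only [Finset.mem_filter]
  constructor
  · exact fun h => h.2
  · intro h
    refine ⟨?_, h⟩
    rw [Fintype.mem_piFinset]
    intro k
    rw [Finset.mem_Icc]
    have h2 := coord_sq_le x k
    rw [h.2] at h2
    constructor <;> nlinarith

theorem Sh_val {x : W} (hx : x ∈ Sh C) (k : Fin 24) :
    x k = 1 ∨ x k = -1 ∨ x k = 3 ∨ x k = -3 := by
  obtain ⟨_, h2, h3⟩ := mem_Sh.1 hx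
  have := odd_bound h2 h3 k
  obtain ⟨e, he⟩ := h2 k
  omega

theorem neg_Sh {x : W} (hx : x ∈ Sh C) : -x ∈ Sh C := by
  obtain ⟨h1, h2, h3⟩ := mem_Sh.1 hx
  refine mem_Sh.2 ⟨h1.neg, fun k => (h2 k).neg, ?_⟩
  rw [neg_dotProduct_neg, h3]

theorem neg_R {x : W} (hx : x ∈ R C) : -x ∈ R C := by
  obtain ⟨h1, h3⟩ := mem_R.1 hx
  refine mem_R.2 ⟨h1.neg, ?_⟩
  rw [neg_dotProduct_neg, h3]

theorem sum_Sh (hC : SelfDual C) (hm : MinWt C) (f : W → ℤ) :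
    ∑ x ∈ Sh C, f x = ∑ c ∈ ShW C, f (fun k => dl (c k)) := by
  have hdl : ∀ t : ZMod 5, ((dl t : ℤ) : ZMod 5) = t := by decide
  have hval : ∀ x ∈ Sh C, ∀ k, dl ((x k : ℤ) : ZMod 5) = x k ∧
      4 * chi ((x k : ℤ) : ZMod 5) = 5 - x k * x k := by
    intro x hx k
    rcases Sh_val hx k with h | h | h | h <;> rw [h] <;> decide
  refine Finset.sum_bij' (fun x _ k => ((x k : ℤ) : ZMod 5)) (fun c _ k => dl (c k)) ?_ ?_ ?_ ?_ ?_
  · intro x hx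
    obtain ⟨h1, h2, h3⟩ := mem_Sh.1 hx
    refine mem_ShW.2 ⟨h1, ?_⟩
    have : 4 * D (fun k => ((x k : ℤ) : ZMod 5)) = 80 := by
      unfold D
      rw [Finset.mul_sum, Finset.sum_congr rfl (fun k _ => (hval x hx k).2),
        Finset.sum_sub_distrib]
      have h4 : ∑ k, x k * x k = 40 := h3
      rw [h4]
      simp
    omega
  · intro c hc
    have hne := ne_zero_of_ShW hC hm hc
    obtain ⟨h1, h2⟩ := mem_ShW.1 hc
    refine mem_Sh.2 ⟨?_, ?_, ?_⟩
    · unfold inC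
      simpa only [hdl] using h1
    · intro k
      have : ∀ t : ZMod 5, t ≠ 0 → Odd (dl t) := by decide
      exact this _ (hne k)
    · have e : ∀ t : ZMod 5, t ≠ 0 → dl t * dl t = 5 - 4 * chi t := by decide
      unfold dotProduct
      rw [Finset.sum_congr rfl (fun k _ => e (c k) (hne k)), Finset.sum_sub_distrib,
        ← Finset.mul_sum]
      have : ∑ k, chi (c k) = 20 := h2
      rw [this]
      simp
  · intro x hx
    funext k
    exact (hval x hx k).1
  · intro c hc
    funext k
    exact hdl _
  · intro x hx
    congr 1
    funext k
    exact ((hval x hx k).1).symm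

theorem card_Sh (hC : SelfDual C) (hm : MinWt C) : (Sh C).card = 576 := by
  have h := sum_Sh hC hm (fun _ => 1)
  simp only [Finset.sum_const, nsmul_eq_mul, mul_one] at h
  rw [card_ShW hC hm] at h
  exact_mod_cast h

theorem frame_Sh (hC : SelfDual C) (hm : MinWt C) (u v : W) :
    ∑ d ∈ Sh C, (d ⬝ᵥ u) * (d ⬝ᵥ v) = 960 * (u ⬝ᵥ v) := by
  have e : ∀ d : W, (d ⬝ᵥ u) * (d ⬝ᵥ v) = ∑ i, ∑ j, (u i * v j) * (d i * d j) := by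
    intro d
    unfold dotProduct
    rw [Finset.sum_mul_sum]
    refine Finset.sum_congr rfl fun i _ => Finset.sum_congr rfl fun j _ => ?_
    ring
  simp only [e]
  rw [Finset.sum_comm]
  have e2 : ∀ i, ∑ d ∈ Sh C, ∑ j, (u i * v j) * (d i * d j) = 960 * (u i * v i) := by
    intro i
    rw [Finset.sum_comm]
    have : ∀ j, ∑ d ∈ Sh C, (u i * v j) * (d i * d j)
        = if i = j then 960 * (u i * v j) else 0 := by
      intro j
      rw [← Finset.mul_sum, sum_Sh hC hm (fun d => d i * d j), frame hC hm]
      split_ifs <;> ring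
    simp only [this]
    simp
  simp only [e2, ← Finset.mul_sum]
  rfl

end lattice
end SD24

namespace SD24
section endgame
variable {C : Submodule (ZMod 5) V}

theorem half_sub {d e : W} (hd : d ∈ Sh C) (he : e ∈ Sh C) :
    ∃ z, inC C z ∧ e = d - (2:ℤ) • z := by
  obtain ⟨h1, h2, h3⟩ := mem_Sh.1 hd
  obtain ⟨g1, g2, g3⟩ := mem_Sh.1 he
  have key : d - e = (2:ℤ) • (fun k => (d k - e k) / 2) := by
    funext k
    obtain ⟨a, ha⟩ := h2 k
    obtain ⟨b, hb⟩ := g2 k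
    simp only [Pi.sub_apply, Pi.smul_apply, smul_eq_mul]
    omega
  refine ⟨fun k => (d k - e k) / 2, ?_, ?_⟩
  · apply inC.half
    rw [← key]
    exact h1.sub g1
  · rw [← key]
    abel

theorem half_dots {d z : W} (n : (d - (2:ℤ) • z) ⬝ᵥ (d - (2:ℤ) • z) = 40) (h : d ⬝ᵥ d = 40) :
    z ⬝ᵥ z = d ⬝ᵥ z ∧ d ⬝ᵥ (d - (2:ℤ) • z) = 40 - 2 * (z ⬝ᵥ z) := by
  have c := dotProduct_comm z d
  simp only [sub_dotProduct, dotProduct_sub, smul_dotProduct, dotProduct_smul, smul_eq_mul, c] at *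
  constructor <;> linarith

/-- the vector `(d - e) / 2` together with its norm -/
theorem half_norm {d e : W} (hd : d ∈ Sh C) (he : e ∈ Sh C) :
    ∃ z, inC C z ∧ e = d - (2:ℤ) • z ∧ d ⬝ᵥ e = 40 - 2 * (z ⬝ᵥ z) := by
  obtain ⟨z, hz, hze⟩ := half_sub hd he
  refine ⟨z, hz, hze, ?_⟩
  have := (mem_Sh.1 he).2.2
  rw [hze] at this ⊢
  exact (half_dots this (mem_Sh.1 hd).2.2).2

/-- the vector `(d + e) / 2` together with its norm -/
theorem half_norm' {d e : W} (hd : d ∈ Sh C) (he : e ∈ Sh C) :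
    ∃ z, inC C z ∧ e = (2:ℤ) • z - d ∧ d ⬝ᵥ e = 2 * (z ⬝ᵥ z) - 40 := by
  obtain ⟨z, hz, h1, h2⟩ := half_norm hd (neg_Sh he)
  refine ⟨z, hz, ?_, ?_⟩
  · rw [← neg_neg e, h1]
    abel
  · rw [dotProduct_neg] at h2
    linarith

theorem norm_cases (hC : SelfDual C) (hm : MinWt C) {z : W} (hz : inC C z) :
    5 ∣ z ⬝ᵥ z ∧ (z = 0 ∨ 10 ≤ z ⬝ᵥ z) := by
  refine ⟨five_dvd_dot hC hz hz, ?_⟩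
  by_cases h : z ⬝ᵥ z < 10
  · exact Or.inl (norm_lt hm hz h)
  · exact Or.inr (by omega)

theorem dot_vals (hC : SelfDual C) (hm : MinWt C) {d e : W} (hd : d ∈ Sh C) (he : e ∈ Sh C) :
    e = d ∨ e = -d ∨ d ⬝ᵥ e = 20 ∨ d ⬝ᵥ e = 10 ∨ d ⬝ᵥ e = 0 ∨ d ⬝ᵥ e = -10 ∨ d ⬝ᵥ e = -20 := by
  obtain ⟨z, hz, h1, h2⟩ := half_norm hd he
  obtain ⟨y, hy, g1, g2⟩ := half_norm' hd he
  obtain ⟨⟨a, ha⟩, h3⟩ := norm_cases hC hm hz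
  obtain ⟨⟨b, hb⟩, g3⟩ := norm_cases hC hm hy
  rcases h3 with h3 | h3
  · left; rw [h1, h3]; simp
  rcases g3 with g3 | g3
  · right; left; rw [g1, g3]; simp
  right; right
  omega

theorem dot_parity (hC : SelfDual C) {d e f : W} (hd : d ∈ Sh C) (he : e ∈ Sh C)
    (hf : f ∈ Sh C) : 20 ∣ d ⬝ᵥ e + d ⬝ᵥ f + e ⬝ᵥ f := by
  obtain ⟨z, hz, h1⟩ := half_sub hd he
  obtain ⟨y, hy, g1⟩ := half_sub hd hf
  have hdd := (mem_Sh.1 hd).2.2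
  have hdc := (mem_Sh.1 hd).1
  obtain ⟨a, ha⟩ := five_dvd_dot hC hdc hz
  obtain ⟨b, hb⟩ := five_dvd_dot hC hdc hy
  obtain ⟨c, hc⟩ := five_dvd_dot hC hz hy
  refine ⟨6 - a - b + c, ?_⟩
  have k := dotProduct_comm z d
  rw [h1, g1]
  simp only [sub_dotProduct, dotProduct_sub, smul_dotProduct, dotProduct_smul, smul_eq_mul, k,
    ha, hb, hc, hdd]
  ring

/-- Cauchy-Schwarz for Gram matrices -/
theorem gram_cs (S : Finset W) (h : ∀ d ∈ S, d ⬝ᵥ d = 40) :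
    (40 * (S.card : ℤ)) ^ 2 ≤ 24 * ∑ d ∈ S, ∑ e ∈ S, (d ⬝ᵥ e) ^ 2 := by
  set M : Fin 24 → Fin 24 → ℤ := fun i j => ∑ d ∈ S, d i * d j with hM
  have h1 : ∑ d ∈ S, ∑ e ∈ S, (d ⬝ᵥ e) ^ 2 = ∑ i, ∑ j, (M i j) ^ 2 := by
    have e1 : ∀ d e : W, (d ⬝ᵥ e) ^ 2 = ∑ i, ∑ j, (d i * d j) * (e i * e j) := by
      intro d e
      rw [sq]
      unfold dotProduct
      rw [Finset.sum_mul_sum]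
      refine Finset.sum_congr rfl fun i _ => Finset.sum_congr rfl fun j _ => ?_
      ring
    have e2 : ∀ i j, (M i j) ^ 2 = ∑ d ∈ S, ∑ e ∈ S, (d i * d j) * (e i * e j) := by
      intro i j
      rw [sq, hM, Finset.sum_mul_sum]
    simp only [e1, e2]
    rw [Finset.sum_congr rfl (fun d _ => Finset.sum_comm)]
    rw [Finset.sum_comm]
    refine Finset.sum_congr rfl fun i _ => ?_
    rw [Finset.sum_congr rfl (fun d _ => Finset.sum_comm)]
    rw [Finset.sum_comm]
  have h2 : ∑ i, (M i i) ^ 2 ≤ ∑ i, ∑ j, (M i j) ^ 2 :=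
    Finset.sum_le_sum fun i _ =>
      Finset.single_le_sum (f := fun j => (M i j) ^ 2) (fun j _ => sq_nonneg _) (Finset.mem_univ i)
  have h3 : ∑ i, M i i = 40 * (S.card : ℤ) := by
    rw [hM, Finset.sum_comm]
    have : ∀ d ∈ S, ∑ i, d i * d i = 40 := h
    rw [Finset.sum_congr rfl this]
    simp [mul_comm]
  have h4 : (∑ i, M i i) ^ 2 ≤ 24 * ∑ i, (M i i) ^ 2 := by
    have := sq_sum_le_card_mul_sum_sq (s := Finset.univ) (f := fun i => M i i)
    simpa using this
  rw [h1, ← h3]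
  linarith

theorem ten_of (hC : SelfDual C) (hm : MinWt C) {d e : W} (hd : d ∈ Sh C) (he : e ∈ Sh C)
    (h : ¬ 20 ∣ d ⬝ᵥ e) : d ⬝ᵥ e = 10 ∨ d ⬝ᵥ e = -10 := by
  have hdd := (mem_Sh.1 hd).2.2
  rcases dot_vals hC hm hd he with k | k | k | k | k | k | k
  · rw [k, hdd] at h; omega
  · rw [k, dotProduct_neg, hdd] at h; omega
  all_goals omega

set_option maxRecDepth 10000 in
theorem not_ten (hC : SelfDual C) (hm : MinWt C) {d0 e0 : W} (hd0 : d0 ∈ Sh C)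
    (he0 : e0 ∈ Sh C) : 20 ∣ d0 ⬝ᵥ e0 := by
  classical
  by_contra hcon
  set S1 := (Sh C).filter (fun d => 20 ∣ d0 ⬝ᵥ d) with hS1
  set S3 := (Sh C).filter (fun d => ¬ 20 ∣ d0 ⬝ᵥ d) with hS3
  have hcard : S1.card + S3.card = 576 := by
    rw [← card_Sh hC hm]
    exact Finset.card_filter_add_card_filter_not _
  have h1pos : 0 < S1.card := by
    refine Finset.card_pos.2 ⟨d0, Finset.mem_filter.2 ⟨hd0, ?_⟩⟩
    rw [(mem_Sh.1 hd0).2.2]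
    norm_num
  have h3pos : 0 < S3.card := Finset.card_pos.2 ⟨e0, Finset.mem_filter.2 ⟨he0, hcon⟩⟩
  have hrow : ∀ d ∈ S3, ∑ e ∈ S3, (d ⬝ᵥ e) ^ 2 = 38400 - 100 * (S1.card : ℤ) := by
    intro d hd
    obtain ⟨hd1, hd2⟩ := Finset.mem_filter.1 hd
    have hf := frame_Sh hC hm d d
    rw [(mem_Sh.1 hd1).2.2] at hf
    rw [← Finset.sum_filter_add_sum_filter_not (Sh C) (fun d => 20 ∣ d0 ⬝ᵥ d)] at hf
    rw [← hS1, ← hS3] at hf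
    have a1 : ∑ e ∈ S1, (e ⬝ᵥ d) * (e ⬝ᵥ d) = 100 * (S1.card : ℤ) := by
      rw [Finset.sum_congr rfl (g := fun _ => (100:ℤ))]
      · simp [mul_comm]
      · intro e he
        obtain ⟨he1, he2⟩ := Finset.mem_filter.1 he
        have hp := dot_parity hC hd0 hd1 he1
        have t0 := ten_of hC hm hd0 hd1 hd2
        have this : ¬ (20:ℤ) ∣ d ⬝ᵥ e := by omega
        have t1 : d ⬝ᵥ e = 10 ∨ d ⬝ᵥ e = -10 := ten_of hC hm hd1 he1 this
        rw [dotProduct_comm e d]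
        rcases t1 with k | k
        · rw [k]; norm_num
        · rw [k]; norm_num
    have a2 : ∑ e ∈ S3, (e ⬝ᵥ d) * (e ⬝ᵥ d) = ∑ e ∈ S3, (d ⬝ᵥ e) ^ 2 :=
      Finset.sum_congr rfl fun e _ => by rw [dotProduct_comm e d, sq]
    rw [a1, a2] at hf
    linarith
  have h40 : ∀ d ∈ S3, d ⬝ᵥ d = 40 := by
    intro d hd
    exact (mem_Sh.1 (Finset.mem_filter.1 hd).1).2.2
  have hcs := gram_cs S3 h40
  rw [Finset.sum_congr rfl hrow, Finset.sum_const, nsmul_eq_mul] at hcs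
  have hc' : (S1.card : ℤ) = 576 - S3.card := by
    have : (S1.card : ℤ) + S3.card = 576 := by exact_mod_cast hcard
    linarith
  have p1 : (0:ℤ) < S1.card := by exact_mod_cast h1pos
  have p3 : (0:ℤ) < S3.card := by exact_mod_cast h3pos
  rw [hc'] at hcs p1
  nlinarith [mul_pos p1 p3]

theorem dot_vals2 (hC : SelfDual C) (hm : MinWt C) {d e : W} (hd : d ∈ Sh C) (he : e ∈ Sh C) :
    e = d ∨ e = -d ∨ d ⬝ᵥ e = 20 ∨ d ⬝ᵥ e = 0 ∨ d ⬝ᵥ e = -20 := by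
  have := not_ten hC hm hd he
  rcases dot_vals hC hm hd he with k | k | k | k | k | k | k
  · simp [k]
  · simp [k]
  all_goals omega

theorem sum_neg_Sh (f : W → ℤ) : ∑ d ∈ Sh C, f (-d) = ∑ d ∈ Sh C, f d :=
  Finset.sum_nbij' (fun d => -d) (fun d => -d) (fun _ h => neg_Sh h) (fun _ h => neg_Sh h)
    (fun _ _ => neg_neg _) (fun _ _ => neg_neg _) (fun _ _ => rfl)

theorem sum_neg_R (f : W → ℤ) : ∑ d ∈ R C, f (-d) = ∑ d ∈ R C, f d :=
  Finset.sum_nbij' (fun d => -d) (fun d => -d) (fun _ h => neg_R h) (fun _ h => neg_R h)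
    (fun _ _ => neg_neg _) (fun _ _ => neg_neg _) (fun _ _ => rfl)

/-- neighbours -/
noncomputable def nb (C : Submodule (ZMod 5) V) (d : W) : Finset W :=
  (Sh C).filter (fun e => d ⬝ᵥ e = 20)

theorem mem_nb {d e : W} : e ∈ nb C d ↔ e ∈ Sh C ∧ d ⬝ᵥ e = 20 := Finset.mem_filter

theorem sum_nb (hC : SelfDual C) (hm : MinWt C) {d : W} (hd : d ∈ Sh C) (v : W) :
    ∑ e ∈ nb C d, e ⬝ᵥ v = 22 * (d ⬝ᵥ v) := by
  classical
  have hdd := (mem_Sh.1 hd).2.2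
  have hd0 : d ≠ -d := by
    intro h
    have : d ⬝ᵥ d = -(d ⬝ᵥ d) := by
      conv_rhs => rw [← dotProduct_neg, ← h]
    omega
  have hf := frame_Sh hC hm d v
  have hpt : ∀ e ∈ Sh C, (e ⬝ᵥ d) * (e ⬝ᵥ v) =
      20 * (if d ⬝ᵥ e = 20 then e ⬝ᵥ v else 0) + 20 * (if d ⬝ᵥ (-e) = 20 then (-e) ⬝ᵥ v else 0)
      + 40 * (if e = d then d ⬝ᵥ v else 0) + 40 * (if e = -d then d ⬝ᵥ v else 0) := by
    intro e he
    rw [dotProduct_comm e d]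
    rcases dot_vals2 hC hm hd he with k | k | k | k | k
    · subst k
      simp [hdd, hd0]
    · subst k
      simp [hdd, hd0.symm, neg_dotProduct]
    all_goals
      have n1 : e ≠ d := by rintro rfl; omega
      have n2 : e ≠ -d := by rintro rfl; rw [dotProduct_neg] at k; omega
      simp [k, n1, n2, neg_dotProduct]
  rw [Finset.sum_congr rfl hpt] at hf
  simp only [Finset.sum_add_distrib, ← Finset.mul_sum] at hf
  rw [sum_neg_Sh (fun e => if d ⬝ᵥ e = 20 then e ⬝ᵥ v else 0), Finset.sum_ite_eq',
    Finset.sum_ite_eq', if_pos hd, if_pos (neg_Sh hd), ← Finset.sum_filter] at hf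
  change 20 * ∑ e ∈ nb C d, e ⬝ᵥ v + 20 * ∑ e ∈ nb C d, e ⬝ᵥ v + _ + _ = _ at hf
  linarith

theorem card_nb (hC : SelfDual C) (hm : MinWt C) {d : W} (hd : d ∈ Sh C) :
    (nb C d).card = 44 := by
  have h := sum_nb hC hm hd d
  rw [(mem_Sh.1 hd).2.2, Finset.sum_congr rfl (g := fun _ => (20:ℤ))
    (fun e he => by rw [dotProduct_comm]; exact (mem_nb.1 he).2), Finset.sum_const,
    nsmul_eq_mul] at h
  omega

/-- `d - 2 r` -/
theorem sub_two_mem {r d : W} (hr : r ∈ R C) (hd : d ∈ Sh C) (h : d ⬝ᵥ r = 10) :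
    d - (2:ℤ) • r ∈ nb C d := by
  obtain ⟨h1, h2, h3⟩ := mem_Sh.1 hd
  obtain ⟨g1, g2⟩ := mem_R.1 hr
  have c := dotProduct_comm r d
  refine mem_nb.2 ⟨mem_Sh.2 ⟨h1.sub g1.two, ?_, ?_⟩, ?_⟩
  · intro k
    obtain ⟨a, ha⟩ := h2 k
    exact ⟨a - r k, by simp only [Pi.sub_apply, Pi.smul_apply, smul_eq_mul]; omega⟩
  · simp only [sub_dotProduct, dotProduct_sub, smul_dotProduct, dotProduct_smul, smul_eq_mul, c]
    omega
  · simp only [sub_dotProduct, dotProduct_sub, smul_dotProduct, dotProduct_smul, smul_eq_mul, c]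
    omega

theorem nb_half {e d : W} (hd : d ∈ Sh C) (h : e ∈ nb C d) :
    ∃ r ∈ R C, e = d - (2:ℤ) • r ∧ d ⬝ᵥ r = 10 := by
  obtain ⟨he, h20⟩ := mem_nb.1 h
  obtain ⟨z, hz, h1, h2⟩ := half_norm hd he
  refine ⟨z, mem_R.2 ⟨hz, by omega⟩, h1, ?_⟩
  have hdd := (mem_Sh.1 hd).2.2
  rw [h1] at h20
  simp only [dotProduct_sub, dotProduct_smul, smul_eq_mul] at h20
  omega

theorem R_dot (hC : SelfDual C) {r d : W} (hr : r ∈ R C) (hd : d ∈ Sh C) :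
    d ⬝ᵥ r = 0 ∨ d ⬝ᵥ r = 10 ∨ d ⬝ᵥ r = -10 := by
  obtain ⟨h1, h2, h3⟩ := mem_Sh.1 hd
  obtain ⟨g1, g2⟩ := mem_R.1 hr
  have c := dotProduct_comm r d
  have five := five_dvd_dot hC h1 g1
  have two : (2:ℤ) ∣ d ⬝ᵥ r + r ⬝ᵥ r := by
    rw [← add_dotProduct]
    unfold dotProduct
    refine Finset.dvd_sum fun k _ => ?_
    obtain ⟨a, ha⟩ := h2 k
    rw [Pi.add_apply, ha]
    rcases Int.even_or_odd' (r k) with ⟨b, hb | hb⟩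
    · exact Dvd.dvd.mul_left ⟨b, hb⟩ _
    · exact Dvd.dvd.mul_right ⟨a + b + 1, by rw [hb]; ring⟩ _
  have o1 : ∀ k, Odd ((d - (2:ℤ) • r) k) := by
    intro k
    obtain ⟨a, ha⟩ := h2 k
    exact ⟨a - r k, by simp only [Pi.sub_apply, Pi.smul_apply, smul_eq_mul]; omega⟩
  have o2 : ∀ k, Odd ((d + (2:ℤ) • r) k) := by
    intro k
    obtain ⟨a, ha⟩ := h2 k
    exact ⟨a + r k, by simp only [Pi.add_apply, Pi.smul_apply, smul_eq_mul]; omega⟩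
  have b1 := odd_norm o1 0
  have b2 := odd_norm o2 0
  have q1 := odd_sq (o1 0)
  have q2 := odd_sq (o2 0)
  have n1 : (d - (2:ℤ) • r) ⬝ᵥ (d - (2:ℤ) • r) = 80 - 4 * (d ⬝ᵥ r) := by
    simp only [sub_dotProduct, dotProduct_sub, smul_dotProduct, dotProduct_smul, smul_eq_mul, c]
    omega
  have n2 : (d + (2:ℤ) • r) ⬝ᵥ (d + (2:ℤ) • r) = 80 + 4 * (d ⬝ᵥ r) := by
    simp only [add_dotProduct, dotProduct_add, smul_dotProduct, dotProduct_smul, smul_eq_mul, c]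
    omega
  omega

theorem sum_R_d (hC : SelfDual C) (hm : MinWt C) {d : W} (hd : d ∈ Sh C) (v : W) :
    ∑ r ∈ R C, (d ⬝ᵥ r) * (r ⬝ᵥ v) = 220 * (d ⬝ᵥ v) := by
  classical
  have hpt : ∀ r ∈ R C, (d ⬝ᵥ r) * (r ⬝ᵥ v) =
      10 * (if d ⬝ᵥ r = 10 then r ⬝ᵥ v else 0)
        + 10 * (if d ⬝ᵥ (-r) = 10 then (-r) ⬝ᵥ v else 0) := by
    intro r hr
    rcases R_dot hC hr hd with k | k | k <;> simp [k, neg_dotProduct]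
  rw [Finset.sum_congr rfl hpt, Finset.sum_add_distrib, ← Finset.mul_sum, ← Finset.mul_sum,
    sum_neg_R (fun r => if d ⬝ᵥ r = 10 then r ⬝ᵥ v else 0), ← Finset.sum_filter]
  have h2 : ∑ r ∈ (R C).filter (fun r => d ⬝ᵥ r = 10), (d ⬝ᵥ v - 2 * (r ⬝ᵥ v))
      = ∑ e ∈ nb C d, e ⬝ᵥ v := by
    refine Finset.sum_nbij (fun r => d - (2:ℤ) • r) ?_ ?_ ?_ ?_
    · intro r hr
      obtain ⟨h1, h2⟩ := Finset.mem_filter.1 hr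
      exact sub_two_mem h1 hd h2
    · intro a _ b _ h
      funext k
      have := congrFun h k
      simp only [Pi.sub_apply, Pi.smul_apply, smul_eq_mul] at this
      omega
    · intro e he
      obtain ⟨r, hr, h1, h2⟩ := nb_half hd he
      exact ⟨r, Finset.mem_coe.2 (Finset.mem_filter.2 ⟨hr, h2⟩), h1.symm⟩
    · intro r _
      simp only [sub_dotProduct, smul_dotProduct, smul_eq_mul]
  have h3 : ((R C).filter (fun r => d ⬝ᵥ r = 10)).card = (nb C d).card := by
    refine Finset.card_nbij (fun r => d - (2:ℤ) • r) ?_ ?_ ?_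
    · intro r hr
      obtain ⟨h1, h2⟩ := Finset.mem_filter.1 hr
      exact sub_two_mem h1 hd h2
    · intro a _ b _ h
      funext k
      have := congrFun h k
      simp only [Pi.sub_apply, Pi.smul_apply, smul_eq_mul] at this
      omega
    · intro e he
      obtain ⟨r, hr, h1, h2⟩ := nb_half hd he
      exact ⟨r, Finset.mem_coe.2 (Finset.mem_filter.2 ⟨hr, h2⟩), h1.symm⟩
  rw [sum_nb hC hm hd, Finset.sum_sub_distrib, Finset.sum_const, h3, card_nb hC hm hd,
    ← Finset.mul_sum, nsmul_eq_mul] at h2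
  push_cast at h2
  linarith

theorem frame_R (hC : SelfDual C) (hm : MinWt C) (u v : W) :
    ∑ r ∈ R C, (r ⬝ᵥ u) * (r ⬝ᵥ v) = 220 * (u ⬝ᵥ v) := by
  have h1 : 960 * ∑ r ∈ R C, (r ⬝ᵥ u) * (r ⬝ᵥ v)
      = ∑ d ∈ Sh C, ∑ r ∈ R C, (d ⬝ᵥ u) * ((d ⬝ᵥ r) * (r ⬝ᵥ v)) := by
    rw [Finset.sum_comm, Finset.mul_sum]
    refine Finset.sum_congr rfl fun r _ => ?_
    have := frame_Sh hC hm u r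
    rw [dotProduct_comm r u, ← mul_assoc, ← this, Finset.sum_mul]
    refine Finset.sum_congr rfl fun d _ => ?_
    ring
  have h2 : ∑ d ∈ Sh C, ∑ r ∈ R C, (d ⬝ᵥ u) * ((d ⬝ᵥ r) * (r ⬝ᵥ v))
      = 220 * (960 * (u ⬝ᵥ v)) := by
    rw [← frame_Sh hC hm u v, Finset.mul_sum]
    refine Finset.sum_congr rfl fun d hd => ?_
    rw [← Finset.mul_sum, sum_R_d hC hm hd]
    ring
  linarith

end endgame
end SD24

namespace SD24
section endgame2
variable {C : Submodule (ZMod 5) V}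

/-- shadow vectors with first entry 3 -/
noncomputable def T (C : Submodule (ZMod 5) V) : Finset W := (Sh C).filter (fun d => d 0 = 3)

/-- norm 10 vectors with first entry 1 -/
noncomputable def P (C : Submodule (ZMod 5) V) : Finset W := (R C).filter (fun d => d 0 = 1)

theorem mem_T {d : W} : d ∈ T C ↔ d ∈ Sh C ∧ d 0 = 3 := Finset.mem_filter

theorem mem_P {d : W} : d ∈ P C ↔ d ∈ R C ∧ d 0 = 1 := Finset.mem_filter

/-- first basis vector -/
def e0 : W := Pi.single 0 1

theorem dot_e0 (x : W) : x ⬝ᵥ e0 = x 0 := dotProduct_single_one x 0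

theorem card_T (hC : SelfDual C) (hm : MinWt C) : (T C).card = 24 := by
  have hf := frame_Sh hC hm e0 e0
  have h1 : e0 ⬝ᵥ e0 = 1 := by rw [dot_e0]; simp [e0]
  have hpt : ∀ d ∈ Sh C, (d ⬝ᵥ e0) * (d ⬝ᵥ e0) =
      1 + 8 * (if d 0 = 3 then 1 else 0) + 8 * (if (-d) 0 = 3 then 1 else 0) := by
    intro d hd
    rw [dot_e0, Pi.neg_apply]
    rcases Sh_val hd 0 with k | k | k | k <;> rw [k] <;> norm_num
  rw [Finset.sum_congr rfl hpt, h1] at hf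
  simp only [Finset.sum_add_distrib, ← Finset.mul_sum] at hf
  rw [sum_neg_Sh (fun d => if d 0 = 3 then 1 else 0), Finset.sum_boole, Finset.sum_const,
    card_Sh hC hm] at hf
  change _ + 8 * ((T C).card : ℤ) + 8 * ((T C).card : ℤ) = _ at hf
  norm_num at hf
  omega

theorem R_val (hm : MinWt C) {r : W} (hr : r ∈ R C) : r 0 = 1 ∨ r 0 = 0 ∨ r 0 = -1 := by
  obtain ⟨h1, h2⟩ := mem_R.1 hr
  have := norm_ten hm h1 h2 0
  omega

theorem sum_P (hC : SelfDual C) (hm : MinWt C) (v : W) : ∑ r ∈ P C, r ⬝ᵥ v = 110 * v 0 := by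
  have hf := frame_R hC hm e0 v
  have hpt : ∀ r ∈ R C, (r ⬝ᵥ e0) * (r ⬝ᵥ v) =
      (if r 0 = 1 then r ⬝ᵥ v else 0) + (if (-r) 0 = 1 then (-r) ⬝ᵥ v else 0) := by
    intro r hr
    rw [dot_e0, Pi.neg_apply, neg_dotProduct]
    rcases R_val hm hr with k | k | k <;> rw [k] <;> norm_num
  rw [Finset.sum_congr rfl hpt, Finset.sum_add_distrib,
    sum_neg_R (fun r => if r 0 = 1 then r ⬝ᵥ v else 0), ← Finset.sum_filter,
    dotProduct_comm e0 v, dot_e0] at hf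
  change ∑ r ∈ P C, r ⬝ᵥ v + ∑ r ∈ P C, r ⬝ᵥ v = _ at hf
  linarith

theorem card_P (hC : SelfDual C) (hm : MinWt C) : (P C).card = 110 := by
  have h := sum_P hC hm e0
  rw [Finset.sum_congr rfl (g := fun _ => (1:ℤ))
    (fun r hr => by rw [dot_e0]; exact (mem_P.1 hr).2)] at h
  simp [e0] at h
  exact_mod_cast h

theorem sum_P_sq (hC : SelfDual C) (hm : MinWt C) (v : W) :
    ∑ r ∈ P C, (r ⬝ᵥ v) * (r ⬝ᵥ v) ≤ 110 * (v ⬝ᵥ v) := by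
  have hf := frame_R hC hm v v
  have hpt : ∀ r ∈ R C,
      (if r 0 = 1 then (r ⬝ᵥ v) * (r ⬝ᵥ v) else 0)
        + (if (-r) 0 = 1 then ((-r) ⬝ᵥ v) * ((-r) ⬝ᵥ v) else 0) ≤ (r ⬝ᵥ v) * (r ⬝ᵥ v) := by
    intro r hr
    rw [Pi.neg_apply, neg_dotProduct]
    rcases R_val hm hr with k | k | k <;> rw [k] <;> norm_num
    exact mul_self_nonneg _
  have h := Finset.sum_le_sum hpt
  rw [Finset.sum_add_distrib,
    sum_neg_R (fun r => if r 0 = 1 then (r ⬝ᵥ v) * (r ⬝ᵥ v) else 0), ← Finset.sum_filter] at h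
  change ∑ r ∈ P C, (r ⬝ᵥ v) * (r ⬝ᵥ v) + ∑ r ∈ P C, (r ⬝ᵥ v) * (r ⬝ᵥ v) ≤ _ at h
  linarith

theorem T_dot (hC : SelfDual C) (hm : MinWt C) {d e : W} (hd : d ∈ T C) (he : e ∈ T C) :
    e = d ∨ d ⬝ᵥ e = 20 ∨ d ⬝ᵥ e = 0 := by
  obtain ⟨hd1, hd2⟩ := mem_T.1 hd
  obtain ⟨he1, he2⟩ := mem_T.1 he
  rcases dot_vals2 hC hm hd1 he1 with k | k | k | k | k
  · exact Or.inl k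
  · exfalso
    rw [k, Pi.neg_apply] at he2
    omega
  · exact Or.inr (Or.inl k)
  · exact Or.inr (Or.inr k)
  · exfalso
    obtain ⟨z, hz, h1, h2⟩ := half_norm' hd1 he1
    have h3 := norm_ten hm hz (by omega) 0
    rw [h1] at he2
    simp only [Pi.sub_apply, Pi.smul_apply, smul_eq_mul] at he2
    omega

/-- fact (A) -/
theorem no_common_R (hm : MinWt C) {d e r : W} (hd : d ∈ T C) (he : e ∈ T C) (h : d ⬝ᵥ e = 0)
    (hr : r ∈ R C) (h1 : d ⬝ᵥ r = 10) (h2 : e ⬝ᵥ r = 10) : False := by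
  obtain ⟨hd1, hd2⟩ := mem_T.1 hd
  obtain ⟨he1, he2⟩ := mem_T.1 he
  obtain ⟨g1, g2⟩ := mem_R.1 hr
  obtain ⟨z, hz, k1, k2⟩ := half_norm' hd1 he1
  have hzr : z ⬝ᵥ r = 10 := by
    rw [k1] at h2
    simp only [sub_dotProduct, smul_dotProduct, smul_eq_mul] at h2
    omega
  have hn : (z - r) ⬝ᵥ (z - r) = 10 := by
    simp only [sub_dotProduct, dotProduct_sub, dotProduct_comm r z]
    omega
  have h3 := norm_ten hm (hz.sub g1) hn 0
  have h4 := norm_ten hm g1 g2 0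
  rw [k1] at he2
  simp only [Pi.sub_apply, Pi.smul_apply, smul_eq_mul] at he2 h3
  omega

/-- fact (B) -/
theorem no_common_nb (hC : SelfDual C) (hm : MinWt C) {d e f : W} (hd : d ∈ T C) (he : e ∈ T C)
    (hf : f ∈ T C) (h : d ⬝ᵥ e = 0) (h1 : d ⬝ᵥ f = 20) (h2 : e ⬝ᵥ f = 20) : False := by
  obtain ⟨hd1, hd2⟩ := mem_T.1 hd
  obtain ⟨he1, he2⟩ := mem_T.1 he
  obtain ⟨hf1, hf2⟩ := mem_T.1 hf
  have hs := frame_R hC hm d e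
  rw [h] at hs
  have hle : ∀ r ∈ R C, (r ⬝ᵥ d) * (r ⬝ᵥ e) ≤ 0 := by
    intro r hr
    rw [dotProduct_comm r d, dotProduct_comm r e]
    rcases R_dot hC hr hd1 with k | k | k <;> rcases R_dot hC hr he1 with l | l | l <;>
      rw [k, l] <;> norm_num
    · exact no_common_R hm hd he h hr k l
    · exact no_common_R hm hd he h (neg_R hr) (by rw [dotProduct_neg, k]; norm_num)
        (by rw [dotProduct_neg, l]; norm_num)
  have hz := (Finset.sum_eq_zero_iff_of_nonpos hle).1 (by simpa using hs)
  obtain ⟨r, hr, g1, g2⟩ := nb_half hd1 (mem_nb.2 ⟨hf1, h1⟩)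
  have := hz r hr
  rw [dotProduct_comm r d, dotProduct_comm r e, g2] at this
  rw [g1, dotProduct_sub, dotProduct_comm e d, h, dotProduct_smul, smul_eq_mul] at h2
  omega

theorem T_trans (hC : SelfDual C) (hm : MinWt C) {d e f : W} (hd : d ∈ T C) (he : e ∈ T C)
    (hf : f ∈ T C) (h1 : d ⬝ᵥ f ≠ 0) (h2 : e ⬝ᵥ f ≠ 0) : d ⬝ᵥ e ≠ 0 := by
  intro h
  rcases T_dot hC hm hd hf with k | k | k
  · rw [k, dotProduct_comm] at h2; exact h2 h
  · rcases T_dot hC hm he hf with l | l | l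
    · rw [l] at h1; exact h1 h
    · exact no_common_nb hC hm hd he hf h k l
    · exact h2 l
  · exact h1 k

/-- class of `d` -/
noncomputable def K (C : Submodule (ZMod 5) V) (d : W) : Finset W :=
  (T C).filter (fun e => d ⬝ᵥ e ≠ 0)

theorem mem_K {d e : W} : e ∈ K C d ↔ e ∈ T C ∧ d ⬝ᵥ e ≠ 0 := Finset.mem_filter

theorem K_pair (hC : SelfDual C) (hm : MinWt C) {d e f : W} (hd : d ∈ T C) (he : e ∈ K C d)
    (hf : f ∈ K C d) (hne : e ≠ f) : e ⬝ᵥ f = 20 := by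
  obtain ⟨a, b⟩ := mem_K.1 he
  obtain ⟨a', b'⟩ := mem_K.1 hf
  rw [dotProduct_comm] at b b'
  have := T_trans hC hm a a' hd b b'
  rcases T_dot hC hm a a' with k | k | k
  · exact absurd k.symm hne
  · exact k
  · exact absurd k this

theorem card_K (hC : SelfDual C) (hm : MinWt C) {d : W} (hd : d ∈ T C) : (K C d).card = 12 := by
  classical
  obtain ⟨hd1, hd2⟩ := mem_T.1 hd
  have hdd := (mem_Sh.1 hd1).2.2
  have h1 := sum_nb hC hm hd1 e0
  have hpt : ∀ e ∈ nb C d, e ⬝ᵥ e0 = 1 + 2 * (if e 0 = 3 then 1 else 0) := by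
    intro e he
    obtain ⟨r, hr, g1, g2⟩ := nb_half hd1 he
    have h3 : e 0 = 3 - 2 * r 0 := by
      rw [g1, Pi.sub_apply, hd2]; simp
    have h4 := Sh_val (mem_nb.1 he).1 0
    rw [dot_e0]
    rcases R_val hm hr with k | k | k
    · rw [h3, k]; norm_num
    · rw [h3, k]; norm_num
    · omega
  rw [Finset.sum_congr rfl hpt, Finset.sum_add_distrib, ← Finset.mul_sum, Finset.sum_boole,
    Finset.sum_const, card_nb hC hm hd1, dot_e0, hd2] at h1
  have h2 : K C d = insert d ((nb C d).filter (fun e => e 0 = 3)) := by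
    ext e
    rw [Finset.mem_insert, Finset.mem_filter, mem_K, mem_nb, mem_T]
    constructor
    · rintro ⟨⟨a, b⟩, c⟩
      rcases T_dot hC hm hd (mem_T.2 ⟨a, b⟩) with k | k | k
      · exact Or.inl k
      · exact Or.inr ⟨⟨a, k⟩, b⟩
      · exact absurd k c
    · rintro (k | ⟨⟨a, b⟩, c⟩)
      · rw [k]
        exact ⟨⟨hd1, hd2⟩, by rw [hdd]; norm_num⟩
      · exact ⟨⟨a, c⟩, by rw [b]; norm_num⟩
  rw [h2, Finset.card_insert_of_notMem]
  · norm_num at h1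
    omega
  · rw [Finset.mem_filter, mem_nb, hdd]
    norm_num

open Classical in
/-- vectors of `P` meeting the class -/
noncomputable def Q (C : Submodule (ZMod 5) V) (d : W) : Finset W :=
  (P C).filter (fun r => ∃ e ∈ K C d, e ⬝ᵥ r = 10)

theorem P_dot (hC : SelfDual C) {r d : W} (hr : r ∈ P C) (hd : d ∈ T C) :
    d ⬝ᵥ r = 0 ∨ d ⬝ᵥ r = 10 := by
  obtain ⟨hd1, hd2⟩ := mem_T.1 hd
  obtain ⟨hr1, hr2⟩ := mem_P.1 hr
  rcases R_dot hC hr1 hd1 with k | k | k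
  · exact Or.inl k
  · exact Or.inr k
  · exfalso
    have h := sub_two_mem (neg_R hr1) hd1 (by rw [dotProduct_neg, k]; norm_num)
    have h2 := Sh_val (mem_nb.1 h).1 0
    simp only [Pi.sub_apply, Pi.smul_apply, Pi.neg_apply, smul_eq_mul] at h2
    omega

/-- Gram sums over subsets of a class -/
theorem gram_sum {S A : Finset W} (hA : A ⊆ S) (h40 : ∀ d ∈ S, d ⬝ᵥ d = 40)
    (h20 : ∀ d ∈ S, ∀ e ∈ S, d ≠ e → d ⬝ᵥ e = 20) :
    (∑ d ∈ A, d) ⬝ᵥ (∑ e ∈ S, e) = 20 * A.card * S.card + 20 * A.card := by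
  classical
  rw [sum_dotProduct]
  have : ∀ d ∈ A, d ⬝ᵥ (∑ e ∈ S, e) = 20 * (S.card : ℤ) + 20 := by
    intro d hd
    rw [dotProduct_sum]
    have : ∀ e ∈ S, d ⬝ᵥ e = 20 + (if d = e then 20 else 0) := by
      intro e he
      split_ifs with k
      · rw [← k, h40 d (hA hd)]; norm_num
      · rw [h20 d (hA hd) e he k]; norm_num
    rw [Finset.sum_congr rfl this, Finset.sum_add_distrib, Finset.sum_ite_eq, if_pos (hA hd),
      Finset.sum_const, nsmul_eq_mul]
    ring
  rw [Finset.sum_congr rfl this, Finset.sum_const, nsmul_eq_mul]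
  ring

set_option maxRecDepth 20000 in
theorem card_Q (hC : SelfDual C) (hm : MinWt C) {d : W} (hd : d ∈ T C) : 66 ≤ (Q C d).card := by
  classical
  set S := K C d with hS
  have h12 : S.card = 12 := card_K hC hm hd
  have hST : ∀ e ∈ S, e ∈ T C := fun e he => (mem_K.1 he).1
  have h40 : ∀ e ∈ S, e ⬝ᵥ e = 40 := fun e he => (mem_Sh.1 (mem_T.1 (hST e he)).1).2.2
  have h20 : ∀ e ∈ S, ∀ f ∈ S, e ≠ f → e ⬝ᵥ f = 20 :=
    fun e he f hf hne => K_pair hC hm hd he hf hne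
  set u : W := ∑ e ∈ S, e with hu
  set A : W → Finset W := fun r => S.filter (fun e => e ⬝ᵥ r = 10) with hA
  have hAS : ∀ r, A r ⊆ S := fun r => Finset.filter_subset _ _
  have huu : u ⬝ᵥ u = 3120 := by
    rw [hu, gram_sum (Finset.Subset.refl S) h40 h20, h12]
    norm_num
  have hru : ∀ r ∈ P C, r ⬝ᵥ u = 10 * ((A r).card : ℤ) := by
    intro r hr
    rw [hu, dotProduct_sum]
    have : ∀ e ∈ S, r ⬝ᵥ e = 10 * (if e ⬝ᵥ r = 10 then 1 else 0) := by
      intro e he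
      rw [dotProduct_comm r e]
      rcases P_dot hC hr (hST e he) with k | k <;> rw [k] <;> norm_num
    rw [Finset.sum_congr rfl this, ← Finset.mul_sum, Finset.sum_boole]
  have hquad : ∀ r ∈ P C, 0 ≤ 26 + ((A r).card : ℤ) ^ 2 - 13 * (A r).card := by
    intro r hr
    set k : ℤ := ((A r).card : ℤ) with hk
    set a : W := ∑ e ∈ A r, e with ha
    have q1 : a ⬝ᵥ a = 20 * k * k + 20 * k :=
      gram_sum (Finset.Subset.refl _) (fun e he => h40 e (hAS r he))
        (fun e he f hf => h20 e (hAS r he) f (hAS r hf))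
    have q2 : a ⬝ᵥ u = 260 * k := by
      rw [ha, hu, gram_sum (hAS r) h40 h20, h12]
      push_cast
      ring
    have q3 : a ⬝ᵥ r = 10 * k := by
      rw [ha, sum_dotProduct, Finset.sum_congr rfl (g := fun _ => (10:ℤ))
        (fun e he => (Finset.mem_filter.1 he).2), Finset.sum_const, nsmul_eq_mul]
      ring
    have q4 : r ⬝ᵥ u = 10 * k := hru r hr
    have q5 : r ⬝ᵥ r = 10 := (mem_R.1 (mem_P.1 hr).1).2
    have h := dot_self_nonneg ((26:ℤ) • r - (13:ℤ) • a + k • u)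
    simp only [add_dotProduct, dotProduct_add, sub_dotProduct, dotProduct_sub, smul_dotProduct,
      dotProduct_smul, smul_eq_mul, dotProduct_comm u r, dotProduct_comm r a,
      dotProduct_comm u a, q1, q2, q3, q4, q5, huu] at h
    nlinarith
  have s1 : ∑ r ∈ P C, ((A r).card : ℤ) = 396 := by
    have h := sum_P hC hm u
    rw [Finset.sum_congr rfl hru, ← Finset.mul_sum] at h
    have : u 0 = 36 := by
      rw [hu, Finset.sum_apply, Finset.sum_congr rfl (g := fun _ => (3:ℤ))
        (fun e he => (mem_T.1 (hST e he)).2), Finset.sum_const, h12]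
      norm_num
    rw [this] at h
    linarith
  have s2 : ∑ r ∈ P C, ((A r).card : ℤ) ^ 2 ≤ 3432 := by
    have h := sum_P_sq hC hm u
    rw [huu, Finset.sum_congr rfl (g := fun r => 100 * ((A r).card : ℤ) ^ 2)
      (fun r hr => by rw [hru r hr]; ring), ← Finset.mul_sum] at h
    linarith
  have hpt : ∀ r ∈ P C, 13 * ((A r).card : ℤ) - ((A r).card : ℤ) ^ 2
      ≤ 26 * (if ∃ e ∈ S, e ⬝ᵥ r = 10 then 1 else 0) := by
    intro r hr
    split_ifs with k
    · have := hquad r hr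
      linarith
    · have : A r = ∅ := by
        rw [hA, Finset.filter_eq_empty_iff]
        intro e he h
        exact k ⟨e, he, h⟩
      rw [this]
      norm_num
  have h := Finset.sum_le_sum hpt
  rw [Finset.sum_sub_distrib, ← Finset.mul_sum, ← Finset.mul_sum, s1, Finset.sum_boole] at h
  have hq : (Q C d) = (P C).filter (fun r => ∃ e ∈ S, e ⬝ᵥ r = 10) := by
    unfold Q
    congr
  rw [hq]
  have : (66:ℤ) ≤ ((P C).filter (fun r => ∃ e ∈ S, e ⬝ᵥ r = 10)).card := by linarith
  exact_mod_cast this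

theorem contradiction (hC : SelfDual C) (hm : MinWt C) : False := by
  classical
  have hT := card_T hC hm
  obtain ⟨d, hd⟩ : (T C).Nonempty := Finset.card_pos.1 (by omega)
  obtain ⟨e, he, hek⟩ : ∃ e ∈ T C, e ∉ K C d :=
    Finset.exists_mem_notMem_of_card_lt_card (by rw [hT, card_K hC hm hd]; norm_num)
  have hde : d ⬝ᵥ e = 0 := by
    by_contra h
    exact hek (mem_K.2 ⟨he, h⟩)
  have hdis : Disjoint (Q C d) (Q C e) := by
    rw [Finset.disjoint_left]
    intro r h1 h2
    obtain ⟨hr, a, ha, har⟩ := Finset.mem_filter.1 h1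
    obtain ⟨_, b, hb, hbr⟩ := Finset.mem_filter.1 h2
    obtain ⟨ha1, ha2⟩ := mem_K.1 ha
    obtain ⟨hb1, hb2⟩ := mem_K.1 hb
    have hab : a ⬝ᵥ b = 0 := by
      by_contra h
      have t1 : d ⬝ᵥ b ≠ 0 := T_trans hC hm hd hb1 ha1 ha2 (by rwa [dotProduct_comm])
      exact T_trans hC hm hd he hb1 t1 hb2 hde
    exact no_common_R hm ha1 hb1 hab (mem_P.1 hr).1 har hbr
  have h1 := card_Q hC hm hd
  have h2 := card_Q hC hm he
  have h3 : (Q C d ∪ Q C e).card ≤ (P C).card :=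
    Finset.card_le_card (Finset.union_subset (Finset.filter_subset _ _) (Finset.filter_subset _ _))
  rw [Finset.card_union_of_disjoint hdis, card_P hC hm] at h3
  omega

end endgame2
end SD24

/-- Every self-dual code of length 24 over `𝔽₅` contains a nonzero codeword of
Hamming weight at most 9. -/
theorem self_dual_length_24_F5_min_weight_le_nine
    (C : Submodule (ZMod 5) (Fin 24 → ZMod 5))
    (hsd : ∀ x : Fin 24 → ZMod 5, x ∈ C ↔ ∀ c ∈ C, ∑ i, x i * c i = 0) :
    ∃ c ∈ C, c ≠ 0 ∧ hammingNorm c ≤ 9 := by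
  by_contra! h
  have hm : SD24.MinWt C := fun c hc h0 => h c hc h0
  exact SD24.contradiction hsd hm
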